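/- Let P ⊂ ℝ^n be a flat polyhedron that is strictly star-convex, and let K₁ and K₂ be simplicial triangulations of P that induce the same triangulation of the boundary ∂P. Then there exists s ∈ ℕ and s-fold derived subdivisions β^s K₁ and β^s K₂ (with the interior points on boundary simplices chosen identically, so that β^s K₁ and β^s K₂ still agree on ∂P) such that β^s K₁ and β^s K₂ are bistellar equivalent. -/

import Mathlib

open Set
open scoped Classical

variable {E : Type*} [NormedAddCommGroup E] [NormedSpace ℝ E]

/-- `K'` is a subdivision of `K`: same support, and every simplex of `K'` is contained in
some simplex of `K`. -/
def IsSubdivision (K' K : Geometry.SimplicialComplex ℝ E) : Prop :=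
  K'.space = K.space ∧
    ∀ s ∈ K'.faces, ∃ t ∈ K.faces, convexHull ℝ (s : Set E) ⊆ convexHull ℝ (t : Set E)

/-- `K'` is a derived subdivision of `K`: for each simplex `A` of `K` an interior point `b A`
(in the relative interior of its convex hull; for a vertex this forces `b {x} = x`) is chosen,
and the simplices of `K'` are exactly the convex hulls of the sets `{b A₀, …, b Aₖ}` for chains
`A₀ ⊊ ⋯ ⊊ Aₖ` of simplices of `K`. -/
def IsDerivedSubdivision (K' K : Geometry.SimplicialComplex ℝ E) : Prop :=
  ∃ b : Finset E → E,
    (∀ s ∈ K.faces, b s ∈ intrinsicInterior ℝ (convexHull ℝ (s : Set E))) ∧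
    K'.faces = {S | ∃ T : Finset (Finset E), ↑T ⊆ K.faces ∧ T.Nonempty ∧
      (∀ A ∈ T, ∀ B ∈ T, A ⊆ B ∨ B ⊆ A) ∧ S = T.image b}

/-- `K'` is an `s`-fold iterated derived subdivision of `K`. -/
def IsIterDerived : ℕ → Geometry.SimplicialComplex ℝ E → Geometry.SimplicialComplex ℝ E → Prop
  | 0, K', K => K' = K
  | (s + 1), K', K => ∃ K'', IsIterDerived s K'' K ∧ IsDerivedSubdivision K' K''

/-- The geometric bistellar move `κ(A,B)` on an `n`-dimensional complex: `A` is a simplex of `K`,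
`B` is a simplex not in `K` with `dim A + dim B = n` (i.e. `card A + card B = n + 2`), the link
of `A` in `K` is the boundary complex of `B`, and `K'` is obtained from `K` by replacing
`A ⋆ ∂B` (the simplices containing `A`) with `∂A ⋆ B`; the result is again a geometric
simplicial complex with the same support. -/
def BistellarMove (n : ℕ) (K K' : Geometry.SimplicialComplex ℝ E) : Prop :=
  ∃ A B : Finset E, A ∈ K.faces ∧ B ∉ K.faces ∧ B.Nonempty ∧
    A.card + B.card = n + 2 ∧
    {C : Finset E | C.Nonempty ∧ Disjoint A C ∧ A ∪ C ∈ K.faces} =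
      {C : Finset E | C.Nonempty ∧ C ⊂ B} ∧
    K'.faces = (K.faces \ {s | A ⊆ s}) ∪ {s | ∃ A' : Finset E, A' ⊂ A ∧ s = A' ∪ B} ∧
    K'.space = K.space

/-- `h` is a regular function for the triangulation `K` of a flat `d`-dimensional polyhedron:
it is affine on each simplex of `K` and strictly convex across each codimension-one simplex,
i.e. for `x`, `y` in distinct `d`-simplices sharing a common `(d-1)`-face, the open segment
from `(x, h x)` to `(y, h y)` lies strictly above the graph of `h`. -/
def IsRegularFunction (d : ℕ) (K : Geometry.SimplicialComplex ℝ E) (h : E → ℝ) : Prop :=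
  (∀ s ∈ K.faces, ∃ g : E →ᵃ[ℝ] ℝ, ∀ x ∈ convexHull ℝ (s : Set E), h x = g x) ∧
  (∀ σ ∈ K.faces, ∀ σ' ∈ K.faces, σ ≠ σ' → σ.card = d + 1 → σ'.card = d + 1 →
    (σ ∩ σ').card = d →
    ∀ x ∈ convexHull ℝ (σ : Set E), ∀ y ∈ convexHull ℝ (σ' : Set E),
      ∀ t : ℝ, t ∈ Set.Ioo (0 : ℝ) 1 → (1 - t) • x + t • y ∈ K.space →
        h ((1 - t) • x + t • y) < (1 - t) * h x + t * h y)

/-- `K` is a regular triangulation (of a flat `d`-dimensional polyhedron). -/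
def IsRegularTriangulation (d : ℕ) (K : Geometry.SimplicialComplex ℝ E) : Prop :=
  ∃ h : E → ℝ, IsRegularFunction d K h

/-- `P` is strictly star-convex: there is an interior point `x` such that for every `y ∈ P`
the open segment from `x` to `y` lies in the interior of `P`. -/
def StrictlyStarConvex (P : Set E) : Prop :=
  ∃ x ∈ interior P, ∀ y ∈ P, ∀ t ∈ Set.Ioo (0 : ℝ) 1, (1 - t) • x + t • y ∈ interior P

/-! ### Homogeneous barycentric coordinates -/

/-- The linear map sending a formal combination `∑ cᵢ vᵢ` of points to `(∑ cᵢ • vᵢ, ∑ cᵢ)`. -/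
noncomputable def hbary : (E →₀ ℝ) →ₗ[ℝ] E × ℝ :=
  Finsupp.linearCombination ℝ fun v => (v, (1 : ℝ))

lemma hbary_single (v : E) (c : ℝ) : hbary (Finsupp.single v c) = (c • v, c) := by
  simp [hbary, Finsupp.linearCombination_single]

lemma hbary_eq_sum {w : E →₀ ℝ} {s : Finset E} (h : w.support ⊆ s) :
    hbary w = (∑ v ∈ s, w v • v, ∑ v ∈ s, w v) := by
  rw [hbary, Finsupp.linearCombination_apply, Finsupp.sum_of_support_subset w h _ (by simp)]
  ext <;> simp [Prod.fst_sum, Prod.snd_sum]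

lemma support_indicator_subset' {α : Type*} (s : Finset α) (f : α → ℝ) :
    (Finsupp.indicator s fun v _ => f v).support ⊆ s := by
  intro v hv
  by_contra h
  simp [Finsupp.indicator, h] at hv

lemma indicator_apply_mem {α : Type*} {s : Finset α} (f : α → ℝ) {v : α} (hv : v ∈ s) :
    (Finsupp.indicator s fun v _ => f v) v = f v := by
  simp [Finsupp.indicator, hv]

lemma hbary_indicator (s : Finset E) (f : E → ℝ) :
    hbary (Finsupp.indicator s fun v _ => f v) = (∑ v ∈ s, f v • v, ∑ v ∈ s, f v) := by
  rw [hbary_eq_sum (support_indicator_subset' s f)]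
  congr 1 <;> exact Finset.sum_congr rfl fun v hv => by rw [indicator_apply_mem f hv]

lemma affineIndependent_iff_hbary (s : Finset E) :
    AffineIndependent ℝ ((↑) : s → E) ↔
      ∀ w : E →₀ ℝ, w.support ⊆ s → hbary w = 0 → w = 0 := by
  rw [affineIndependent_iff]
  constructor
  · intro h w hw h0
    rw [hbary_eq_sum hw, Prod.mk_eq_zero] at h0
    have := h Finset.univ (fun i => w i) (by
      rw [Finset.sum_coe_sort s (fun i => w i)]; exact h0.2) (by
      rw [Finset.sum_coe_sort s (fun i => w i • i)]; exact h0.1)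
    ext v
    by_cases hv : v ∈ s
    · exact this ⟨v, hv⟩ (Finset.mem_univ _)
    · exact Finsupp.notMem_support_iff.1 fun h => hv (hw h)
  · intro h t g h1 h2 e he
    let f : E → ℝ := fun v => if hv : v ∈ s then if ⟨v, hv⟩ ∈ t then g ⟨v, hv⟩ else 0 else 0
    have key : ∀ i : s, f i = if i ∈ t then g i else 0 := fun i => by simp [f]
    have h3 := h _ (support_indicator_subset' s f) (by
      rw [hbary_indicator, Prod.mk_eq_zero, ← Finset.sum_coe_sort s (fun i => f i • i),
        ← Finset.sum_coe_sort s f]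
      simp only [key, ite_smul, zero_smul, Finset.sum_ite_mem, Finset.univ_inter]
      exact ⟨h2, h1⟩)
    have h4 := DFunLike.congr_fun h3 (e : E)
    rw [indicator_apply_mem f e.2, key, if_pos he] at h4
    exact h4

lemma mem_convexHull_iff_hbary {s : Finset E} {x : E} :
    x ∈ convexHull ℝ (s : Set E) ↔
      ∃ w : E →₀ ℝ, (∀ v, 0 ≤ w v) ∧ w.support ⊆ s ∧ hbary w = (x, 1) := by
  rw [Finset.mem_convexHull']
  constructor
  · rintro ⟨w, h0, h1, h2⟩
    refine ⟨Finsupp.indicator s fun v _ => w v, fun v => ?_, support_indicator_subset' s w, ?_⟩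
    · by_cases hv : v ∈ s <;> simp [Finsupp.indicator, hv, h0]
    · rw [hbary_indicator, h1, h2]
  · rintro ⟨w, h0, h1, h2⟩
    rw [hbary_eq_sum h1, Prod.mk.injEq] at h2
    exact ⟨w, fun y _ => h0 y, h2.2, h2.1⟩

/-! ### Geometric families of simplices -/

/-- A family of finite sets is geometric if nonnegative weights supported on members of the family
are determined by their weighted sum and total weight. -/
def IsGeometric (F : Set (Finset E)) : Prop :=
  ∀ w u : E →₀ ℝ, (∀ v, 0 ≤ w v) → (∀ v, 0 ≤ u v) → w.support ∈ F → u.support ∈ F →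
    hbary w = hbary u → w = u

lemma ne_zero_of_hbary_eq {w : E →₀ ℝ} {x : E} (h : hbary w = (x, 1)) : w ≠ 0 := by
  rintro rfl
  simpa using congrArg Prod.snd h

lemma hbary_snd_pos {w : E →₀ ℝ} (h0 : ∀ v, 0 ≤ w v) (hw : w ≠ 0) : 0 < (hbary w).2 := by
  rw [hbary_eq_sum subset_rfl]
  refine Finset.sum_pos (fun v hv => lt_of_le_of_ne (h0 v) (Ne.symm (by simpa using hv))) ?_
  simpa using hw

lemma hbary_pos_ext {s : Finset E} (hs : AffineIndependent ℝ ((↑) : s → E)) {w u : E →₀ ℝ}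
    (hw : w.support ⊆ s) (hu : u.support ⊆ s) (h : hbary w = hbary u) : w = u :=
  sub_eq_zero.1 <| (affineIndependent_iff_hbary s).1 hs _
    (Finsupp.support_sub.trans (Finset.union_subset hw hu)) (by rw [map_sub, h, sub_self])

namespace Geometry.SimplicialComplex

variable (K : Geometry.SimplicialComplex ℝ E)

lemma isGeometric : IsGeometric K.faces := by
  intro w u w0 u0 hw hu h
  have hpos : 0 < (hbary w).2 :=
    hbary_snd_pos w0 (by rintro rfl; exact K.empty_notMem (by simpa using hw))
  set c := (hbary w).2 with hc
  have nrm : ∀ y : E →₀ ℝ, hbary y = hbary w → hbary (c⁻¹ • y) = (c⁻¹ • (hbary w).1, 1) := by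
    intro y hy
    rw [map_smul, hy]
    ext
    · rfl
    · simp [← hc, hpos.ne']
  have pos : ∀ y : E →₀ ℝ, (∀ v, 0 ≤ y v) → ∀ v, 0 ≤ (c⁻¹ • y) v := fun y hy v => by
    simpa using mul_nonneg (inv_nonneg.2 hpos.le) (hy v)
  have m1 : c⁻¹ • (hbary w).1 ∈ convexHull ℝ (w.support : Set E) :=
    mem_convexHull_iff_hbary.2 ⟨c⁻¹ • w, pos w w0, Finsupp.support_smul, nrm w rfl⟩
  have m2 : c⁻¹ • (hbary w).1 ∈ convexHull ℝ (u.support : Set E) :=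
    mem_convexHull_iff_hbary.2 ⟨c⁻¹ • u, pos u u0, Finsupp.support_smul, nrm u h.symm⟩
  have m3 := K.inter_subset_convexHull hw hu ⟨m1, m2⟩
  rw [← Finset.coe_inter, mem_convexHull_iff_hbary] at m3
  obtain ⟨y, -, hy1, hy2⟩ := m3
  have e1 : c⁻¹ • w = y := hbary_pos_ext (K.indep hw) Finsupp.support_smul
    (hy1.trans Finset.inter_subset_left) ((nrm w rfl).trans hy2.symm)
  have e2 : c⁻¹ • u = y := hbary_pos_ext (K.indep hu) Finsupp.support_smul
    (hy1.trans Finset.inter_subset_right) ((nrm u h.symm).trans hy2.symm)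
  exact smul_right_injective _ (inv_ne_zero hpos.ne') (e1.trans e2.symm)

variable {K}

/-- The carrier of a point is contained in every face containing the point. -/
lemma eq_of_hbary_eq {w u : E →₀ ℝ} {s t : Finset E} (w0 : ∀ v, 0 ≤ w v) (u0 : ∀ v, 0 ≤ u v)
    (hs : s ∈ K.faces) (hw : w.support ⊆ s) (ht : t ∈ K.faces) (hu : u.support ⊆ t)
    (h : hbary w = hbary u) : w = u := by
  by_cases hw0 : w = 0
  · by_contra hne
    have := hbary_snd_pos u0 (fun h' => hne (hw0.trans h'.symm))
    rw [← h, hw0] at this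
    simp at this
  by_cases hu0 : u = 0
  · have := hbary_snd_pos w0 hw0
    rw [h, hu0] at this
    simp at this
  exact K.isGeometric w u w0 u0
    (K.down_closed hs hw (by simpa using hw0)) (K.down_closed ht hu (by simpa using hu0)) h

/-- A downward closed geometric family of nonempty finite sets is a simplicial complex. -/
def ofIsGeometric (F : Set (Finset E)) (hne : ∀ s ∈ F, s.Nonempty)
    (hdown : ∀ s ∈ F, ∀ t ⊆ s, t.Nonempty → t ∈ F) (hF : IsGeometric F) :
    Geometry.SimplicialComplex ℝ E where
  faces := F
  isRelLowerSet_faces := fun s hs => ⟨hne s hs, fun t hts ht => hdown s hs t hts ht⟩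
  indep := by
    intro s hs
    rw [affineIndependent_iff_hbary]
    intro w hw h0
    let p : E →₀ ℝ := Finsupp.indicator s fun v _ => 1 + |w v|
    let q : E →₀ ℝ := p + w
    have hp : ∀ v ∈ s, p v = 1 + |w v| := fun v hv => indicator_apply_mem _ hv
    have hp' : ∀ v ∉ s, p v = 0 := fun v hv =>
      Finsupp.notMem_support_iff.1 fun h => hv (support_indicator_subset' s _ h)
    have hw' : ∀ v ∉ s, w v = 0 := fun v hv => Finsupp.notMem_support_iff.1 fun h => hv (hw h)
    have ps : p.support = s := by
      ext v
      rw [Finsupp.mem_support_iff]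
      by_cases hv : v ∈ s
      · simp only [hp v hv, hv, iff_true]; positivity
      · simp [hp' v hv, hv]
    have qpos : ∀ v ∈ s, 0 < q v := fun v hv => by
      simp only [q, Finsupp.add_apply, hp v hv]
      linarith [neg_abs_le (w v)]
    have qs : q.support = s := by
      ext v
      rw [Finsupp.mem_support_iff]
      by_cases hv : v ∈ s
      · simp only [hv, iff_true]; exact (qpos v hv).ne'
      · simp [q, hp' v hv, hw' v hv, hv]
    have := hF p q (fun v => ?_) (fun v => ?_) (ps ▸ hs) (qs ▸ hs) (by simp [q, h0])
    · simpa [q] using this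
    · by_cases hv : v ∈ s
      · rw [hp v hv]; positivity
      · rw [hp' v hv]
    · by_cases hv : v ∈ s
      · exact (qpos v hv).le
      · simp [q, hp' v hv, hw' v hv]
  inter_subset_convexHull := by
    rintro s t hs ht x ⟨hxs, hxt⟩
    rw [mem_convexHull_iff_hbary] at hxs hxt
    obtain ⟨w, w0, hw, hwx⟩ := hxs
    obtain ⟨u, u0, hu, hux⟩ := hxt
    have ne : ∀ y : E →₀ ℝ, hbary y = (x, 1) → y.support.Nonempty := fun y hy =>
      Finsupp.support_nonempty_iff.2 (ne_zero_of_hbary_eq hy)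
    obtain rfl := hF w u w0 u0 (hdown s hs _ hw (ne w hwx)) (hdown t ht _ hu (ne u hux))
      (hwx.trans hux.symm)
    rw [← Finset.coe_inter, mem_convexHull_iff_hbary]
    exact ⟨w, w0, Finset.subset_inter hw hu, hwx⟩

lemma mem_space_iff_hbary {x : E} :
    x ∈ K.space ↔ ∃ w : E →₀ ℝ, (∀ v, 0 ≤ w v) ∧ w.support ∈ K.faces ∧ hbary w = (x, 1) := by
  rw [mem_space_iff]
  constructor
  · rintro ⟨s, hs, hx⟩
    obtain ⟨w, w0, hw, hwx⟩ := mem_convexHull_iff_hbary.1 hx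
    exact ⟨w, w0, K.down_closed hs hw
      (Finsupp.support_nonempty_iff.2 (ne_zero_of_hbary_eq hwx)), hwx⟩
  · rintro ⟨w, w0, hw, hwx⟩
    exact ⟨_, hw, mem_convexHull_iff_hbary.2 ⟨w, w0, subset_rfl, hwx⟩⟩

end Geometry.SimplicialComplex

/-! ### Bistellar moves from affine dependences -/

/-- Subtracting the largest admissible multiple of a vector with positive part supported on `A`
from nonnegative weights makes some weight on `A` vanish. -/
lemma exists_slide {α : Type*} {A : Finset α} (hA : A.Nonempty) {w ρ : α →₀ ℝ}
    (w0 : ∀ v, 0 ≤ w v) (hρ : ∀ v, 0 < ρ v ↔ v ∈ A) (hw : ∀ v ∈ A, 0 < w v) :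
    ∃ t > (0 : ℝ), (∀ v, 0 ≤ (w - t • ρ) v) ∧ ∃ a ∈ A, (w - t • ρ) a = 0 := by
  obtain ⟨a, ha, hmin⟩ := A.exists_min_image (fun v => w v / ρ v) hA
  have hρa := (hρ a).2 ha
  refine ⟨w a / ρ a, div_pos (hw a ha) hρa, fun v => ?_, a, ha, ?_⟩
  · simp only [Finsupp.sub_apply, Finsupp.smul_apply, smul_eq_mul, sub_nonneg]
    by_cases hv : v ∈ A
    · exact (le_div_iff₀ ((hρ v).2 hv)).1 (hmin v hv)
    · exact (mul_nonpos_of_nonneg_of_nonpos (div_pos (hw a ha) hρa).le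
        (not_lt.1 fun h => hv ((hρ v).1 h))).trans (w0 v)
  · simp [hρa.ne']

/-- An affine dependence that is positive exactly on `A` and negative exactly on `B`, such that
`A` is a face of `T` with link `∂B`. -/
structure IsFlip (T : Geometry.SimplicialComplex ℝ E) (A B : Finset E) (ρ : E →₀ ℝ) : Prop where
  hbary_eq : hbary ρ = 0
  pos_iff : ∀ v, 0 < ρ v ↔ v ∈ A
  neg_iff : ∀ v, ρ v < 0 ↔ v ∈ B
  nonempty : B.Nonempty
  link : ∀ C, Disjoint A C → (A ∪ C ∈ T.faces ↔ C ⊂ B)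

namespace IsFlip

variable {T : Geometry.SimplicialComplex ℝ E} {A B : Finset E} {ρ : E →₀ ℝ}

/-- The faces of the result of the move `κ(A, B)`. -/
def newFaces (T : Geometry.SimplicialComplex ℝ E) (A B : Finset E) : Set (Finset E) :=
  (T.faces \ {s | A ⊆ s}) ∪ {s | ∃ A' : Finset E, A' ⊂ A ∧ s = A' ∪ B}

variable (h : IsFlip T A B ρ)
include h

lemma disjoint : Disjoint A B :=
  Finset.disjoint_left.2 fun v hA hB => ((h.pos_iff v).2 hA).not_gt ((h.neg_iff v).2 hB)

lemma mem_faces : A ∈ T.faces := by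
  simpa using (h.link ∅ (Finset.disjoint_empty_right _)).2 (Finset.empty_ssubset.2 h.nonempty)

lemma nonempty_left : A.Nonempty := T.nonempty_of_mem_faces h.mem_faces

lemma eq_zero {v : E} (hA : v ∉ A) (hB : v ∉ B) : ρ v = 0 :=
  le_antisymm (not_lt.1 fun hv => hA ((h.pos_iff v).1 hv))
    (not_lt.1 fun hv => hB ((h.neg_iff v).1 hv))

lemma notMem_faces : B ∉ T.faces := by
  intro hB
  let p : E →₀ ℝ := Finsupp.indicator A fun v _ => ρ v
  let q : E →₀ ℝ := Finsupp.indicator B fun v _ => -ρ v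
  have hpq : p = q := by
    refine T.eq_of_hbary_eq (fun v => ?_) (fun v => ?_) h.mem_faces
      (support_indicator_subset' _ _) hB (support_indicator_subset' _ _) ?_
    · by_cases hv : v ∈ A <;> simp [p, Finsupp.indicator, hv, ((h.pos_iff v).2 _).le]
    · by_cases hv : v ∈ B <;> simp [q, Finsupp.indicator, hv, ((h.neg_iff v).2 _).le]
    · rw [← sub_eq_zero, ← map_sub, ← h.hbary_eq]
      congr 1
      ext v
      by_cases hA : v ∈ A
      · simp [p, q, Finsupp.indicator, hA, Finset.disjoint_left.1 h.disjoint hA]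
      by_cases hB : v ∈ B
      · simp [p, q, Finsupp.indicator, hA, hB]
      · simp [p, q, Finsupp.indicator, hA, hB, h.eq_zero hA hB]
  obtain ⟨b, hb⟩ := h.nonempty
  have := DFunLike.congr_fun hpq b
  have hbA : b ∉ A := fun hA => Finset.disjoint_left.1 h.disjoint hA hb
  simp only [p, q, Finsupp.indicator_apply, hb, hbA, dite_true, dite_false] at this
  linarith [(h.neg_iff b).2 hb]

lemma sdiff_ssubset {s : Finset E} (hs : s ∈ T.faces) (hA : A ⊆ s) : s \ A ⊂ B :=
  (h.link _ Finset.disjoint_sdiff).1 (by rwa [Finset.union_sdiff_of_subset hA])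

lemma exists_slide_up {w : E →₀ ℝ} (w0 : ∀ v, 0 ≤ w v) {A' : Finset E} (hA' : A' ⊂ A)
    (hw : w.support = A' ∪ B) :
    ∃ t > (0 : ℝ), (∀ v, 0 ≤ (w + t • ρ) v) ∧ A ⊆ (w + t • ρ).support ∧
      (w + t • ρ).support ∈ T.faces := by
  obtain ⟨t, ht, h0, b, hb, hz⟩ := exists_slide (ρ := -ρ) h.nonempty w0
    (fun v => by simpa using h.neg_iff v) (fun v hv => lt_of_le_of_ne (w0 v) (Ne.symm
      (Finsupp.mem_support_iff.1 (hw ▸ Finset.mem_union_right _ hv))))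
  rw [smul_neg, sub_neg_eq_add] at h0 hz
  have hA : A ⊆ (w + t • ρ).support := fun v hv => by
    rw [Finsupp.mem_support_iff, Finsupp.add_apply, Finsupp.smul_apply, smul_eq_mul]
    exact (add_pos_of_nonneg_of_pos (w0 v) (mul_pos ht ((h.pos_iff v).2 hv))).ne'
  refine ⟨t, ht, h0, hA, ?_⟩
  rw [← Finset.union_sdiff_of_subset hA]
  refine (h.link _ Finset.disjoint_sdiff).2 ⟨fun v hv => ?_, fun hB => ?_⟩
  · obtain ⟨hv1, hv2⟩ := Finset.mem_sdiff.1 hv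
    by_contra hvB
    rw [Finsupp.mem_support_iff, Finsupp.add_apply, Finsupp.smul_apply, h.eq_zero hv2 hvB,
      smul_zero, add_zero, ← Finsupp.mem_support_iff, hw, Finset.mem_union] at hv1
    exact hv1.elim (fun h' => hv2 (hA'.1 h')) hvB
  · exact Finsupp.mem_support_iff.1 (Finset.mem_sdiff.1 (hB hb)).1 hz

lemma exists_slide_down {w : E →₀ ℝ} (w0 : ∀ v, 0 ≤ w v) (hw : w.support ∈ T.faces)
    (hA : A ⊆ w.support) :
    ∃ t > (0 : ℝ), (∀ v, 0 ≤ (w - t • ρ) v) ∧ ∃ A' ⊂ A, (w - t • ρ).support = A' ∪ B := by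
  obtain ⟨t, ht, h0, a, ha, hz⟩ := exists_slide (ρ := ρ) h.nonempty_left w0 h.pos_iff
    (fun v hv => lt_of_le_of_ne (w0 v) (Ne.symm (Finsupp.mem_support_iff.1 (hA hv))))
  refine ⟨t, ht, h0, (w - t • ρ).support ∩ A, ⟨Finset.inter_subset_right, fun hs => ?_⟩, ?_⟩
  · exact Finsupp.mem_support_iff.1 (Finset.mem_inter.1 (hs ha)).1 hz
  have hsub := h.sdiff_ssubset hw hA
  ext v
  rw [Finset.mem_union, Finset.mem_inter]
  refine ⟨fun hv => ?_, ?_⟩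
  · by_cases hvA : v ∈ A
    · exact .inl ⟨hv, hvA⟩
    right
    by_contra hvB
    rw [Finsupp.mem_support_iff, Finsupp.sub_apply, Finsupp.smul_apply, h.eq_zero hvA hvB,
      smul_zero, sub_zero, ← Finsupp.mem_support_iff] at hv
    exact hvB (hsub.1 (Finset.mem_sdiff.2 ⟨hv, hvA⟩))
  · rintro (hv | hv)
    · exact hv.1
    · rw [Finsupp.mem_support_iff, Finsupp.sub_apply, Finsupp.smul_apply, smul_eq_mul]
      nlinarith [w0 v, mul_pos_of_neg_of_neg ((h.neg_iff v).2 hv) (neg_lt_zero.2 ht)]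

lemma isGeometric_newFaces : IsGeometric (newFaces T A B) := by
  have cross : ∀ w u : E →₀ ℝ, (∀ v, 0 ≤ w v) → (∀ v, 0 ≤ u v) →
      w.support ∈ T.faces \ {s | A ⊆ s} → (∃ A' ⊂ A, u.support = A' ∪ B) →
      hbary w = hbary u → False := by
    rintro w u w0 u0 hw ⟨A', hA', hu⟩ hwu
    obtain ⟨t, -, h0, hA, hT⟩ := h.exists_slide_up u0 hA' hu
    have := T.isGeometric _ _ w0 h0 hw.1 hT (by rw [map_add, map_smul, h.hbary_eq, hwu]; simp)
    exact hw.2 (this ▸ hA)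
  have same : ∀ (w u : E →₀ ℝ) (t t' : ℝ), (∀ v, 0 ≤ u v) → (∃ A' ⊂ A, w.support = A' ∪ B) →
      w + t • ρ = u + t' • ρ → t' ≤ t := by
    rintro w u t t' u0 ⟨A', hA', hw⟩ e
    by_contra! hlt
    refine hA'.2 fun v hv => ?_
    have e' := DFunLike.congr_fun e v
    simp only [Finsupp.add_apply, Finsupp.smul_apply, smul_eq_mul] at e'
    have : v ∈ w.support := by
      rw [Finsupp.mem_support_iff]
      nlinarith [u0 v, mul_pos (sub_pos.2 hlt) ((h.pos_iff v).2 hv)]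
    rw [hw, Finset.mem_union] at this
    exact this.resolve_right (Finset.disjoint_left.1 h.disjoint hv)
  rintro w u w0 u0 (hw | hw) (hu | hu) hwu
  · exact T.isGeometric w u w0 u0 hw.1 hu.1 hwu
  · exact (cross w u w0 u0 hw hu hwu).elim
  · exact (cross u w u0 w0 hu hw hwu.symm).elim
  · obtain ⟨A₁, hA₁, hw₁⟩ := hw
    obtain ⟨A₂, hA₂, hu₂⟩ := hu
    obtain ⟨t, -, h0, -, hT⟩ := h.exists_slide_up w0 hA₁ hw₁
    obtain ⟨t', -, h0', -, hT'⟩ := h.exists_slide_up u0 hA₂ hu₂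
    have e := T.isGeometric _ _ h0 h0' hT hT' (by simp [h.hbary_eq, hwu])
    obtain rfl := le_antisymm (same u w t' t w0 ⟨A₂, hA₂, hu₂⟩ e.symm)
      (same w u t t' u0 ⟨A₁, hA₁, hw₁⟩ e)
    exact add_right_cancel e

/-- The complex obtained by a bistellar move. -/
def move : Geometry.SimplicialComplex ℝ E :=
  .ofIsGeometric (newFaces T A B)
    (by
      rintro s (hs | ⟨A', -, rfl⟩)
      · exact T.nonempty_of_mem_faces hs.1
      · exact h.nonempty.mono Finset.subset_union_right)
    (by
      rintro s (hs | ⟨A', hA', rfl⟩) t hts ht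
      · exact .inl ⟨T.down_closed hs.1 hts ht, fun hA => hs.2 (hA.trans hts)⟩
      · by_cases hB : B ⊆ t
        · refine .inr ⟨A' ∩ t, Finset.inter_subset_left.trans_ssubset hA', ?_⟩
          ext v
          simp only [Finset.mem_union, Finset.mem_inter]
          have h1 := @hts v
          have h2 := @hB v
          rw [Finset.mem_union] at h1
          tauto
        · refine .inl ⟨T.down_closed (s := A ∪ B ∩ t) ((h.link _ ?_).2 ?_) ?_ ht, fun hA => ?_⟩
          · exact h.disjoint.mono_right Finset.inter_subset_left
          · exact ⟨Finset.inter_subset_left, fun hs => hB (hs.trans Finset.inter_subset_right)⟩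
          · intro v hv
            have h1 := hts hv
            rw [Finset.mem_union] at h1 ⊢
            exact h1.imp (fun h' => hA'.1 h') fun h' => Finset.mem_inter.2 ⟨h', hv⟩
          · refine hA'.2 fun v hv => ?_
            exact (Finset.mem_union.1 (hts (hA hv))).resolve_right
              (Finset.disjoint_left.1 h.disjoint hv))
    h.isGeometric_newFaces

lemma faces_move : h.move.faces = newFaces T A B := rfl

lemma space_move : h.move.space = T.space := by
  ext x
  rw [Geometry.SimplicialComplex.mem_space_iff_hbary,
    Geometry.SimplicialComplex.mem_space_iff_hbary]
  constructor
  · rintro ⟨w, w0, hw | ⟨A', hA', hw⟩, hwx⟩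
    · exact ⟨w, w0, hw.1, hwx⟩
    · obtain ⟨t, -, h0, -, hT⟩ := h.exists_slide_up w0 hA' hw
      exact ⟨_, h0, hT, by rw [map_add, map_smul, h.hbary_eq, hwx]; simp⟩
  · rintro ⟨w, w0, hw, hwx⟩
    by_cases hA : A ⊆ w.support
    · obtain ⟨t, -, h0, A', hA', hs⟩ := h.exists_slide_down w0 hw hA
      exact ⟨_, h0, .inr ⟨A', hA', hs⟩, by rw [map_sub, map_smul, h.hbary_eq, hwx]; simp⟩
    · exact ⟨w, w0, .inl ⟨hw, hA⟩, hwx⟩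

lemma bistellarMove {n : ℕ} (hcard : A.card + B.card = n + 2) : BistellarMove n T h.move := by
  refine ⟨A, B, h.mem_faces, h.notMem_faces, h.nonempty, hcard, ?_, rfl, h.space_move⟩
  ext C
  simp only [Set.mem_ofPred_eq]
  constructor
  · rintro ⟨h1, h2, h3⟩
    exact ⟨h1, (h.link C h2).1 h3⟩
  · rintro ⟨h1, h2⟩
    have h3 := h.disjoint.mono_right h2.1
    exact ⟨h1, h3, (h.link C h3).2 h2⟩

lemma symm : IsFlip h.move B A (-ρ) where
  hbary_eq := by rw [map_neg, h.hbary_eq, neg_zero]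
  pos_iff v := by simpa using h.neg_iff v
  neg_iff v := by simpa using h.pos_iff v
  nonempty := h.nonempty_left
  link C hC := by
    rw [h.faces_move]
    constructor
    · rintro (hs | ⟨A', hA', hs⟩)
      · exact (h.notMem_faces (T.down_closed hs.1 Finset.subset_union_left h.nonempty)).elim
      · have : C = A' := by
          ext v
          have e := Finset.ext_iff.1 hs v
          have h1 : v ∈ B → v ∉ C := fun hv => Finset.disjoint_left.1 hC hv
          have h2 : v ∈ A → v ∉ B := fun hv => Finset.disjoint_left.1 h.disjoint hv
          have h3 : v ∈ A' → v ∈ A := fun hv => hA'.1 hv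
          simp only [Finset.mem_union] at e
          tauto
        exact this ▸ hA'
    · exact fun hCA => .inr ⟨C, hCA, Finset.union_comm _ _⟩

lemma move_symm : h.symm.move = T := by
  ext s
  rw [h.symm.faces_move, newFaces, h.faces_move]
  constructor
  · rintro (⟨hs | ⟨A', -, rfl⟩, hB⟩ | ⟨B', hB', rfl⟩)
    · exact hs.1
    · exact (hB Finset.subset_union_right).elim
    · rw [Finset.union_comm]
      exact (h.link B' (h.disjoint.mono_right hB'.1)).2 hB'
  · intro hs
    by_cases hA : A ⊆ s
    · exact .inr ⟨s \ A, h.sdiff_ssubset hs hA, (Finset.sdiff_union_of_subset hA).symm⟩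
    · exact .inl ⟨.inl ⟨hs, hA⟩, fun hB => h.notMem_faces (T.down_closed hs hB h.nonempty)⟩

/-- A bistellar move can be undone. -/
lemma bistellarMove_symm {n : ℕ} (hcard : A.card + B.card = n + 2) :
    BistellarMove n h.move T := by
  have := h.symm.bistellarMove (n := n) (by omega)
  rwa [h.move_symm] at this

end IsFlip

/-! ### Derived subdivisions -/

lemma mem_intrinsicInterior_of_hbary [FiniteDimensional ℝ E] {s : Finset E} {w : E →₀ ℝ} {x : E}
    (w0 : ∀ v, 0 ≤ w v) (hw : w.support = s) (hx : hbary w = (x, 1)) :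
    x ∈ intrinsicInterior ℝ (convexHull ℝ (s : Set E)) := by
  have hs : s.Nonempty := hw ▸ Finsupp.support_nonempty_iff.2 (ne_zero_of_hbary_eq hx)
  have hpos : ∀ v ∈ s, 0 < w v := fun v hv =>
    lt_of_le_of_ne (w0 v) (Ne.symm (Finsupp.mem_support_iff.1 (hw ▸ hv)))
  obtain ⟨p, hp⟩ := (intrinsicInterior_nonempty (convex_convexHull ℝ (s : Set E))).2
    (by simpa using hs)
  obtain ⟨u, u0, hus, hup⟩ := mem_convexHull_iff_hbary.1 (intrinsicInterior_subset hp)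
  have hune : u.support.Nonempty := Finsupp.support_nonempty_iff.2 (ne_zero_of_hbary_eq hup)
  obtain ⟨t, ht, h0, -⟩ := exists_slide (ρ := u) hune w0 (fun v => by
    rw [Finsupp.mem_support_iff]; exact ⟨ne_of_gt, fun h => lt_of_le_of_ne (u0 v) h.symm⟩)
    (fun v hv => hpos v (hus hv))
  set ε : ℝ := min t (1 / 2) with hε
  have ε0 : 0 < ε := by positivity
  have ε1 : ε < 1 := (min_le_right _ _).trans_lt (by norm_num)
  set y : E := (1 - ε)⁻¹ • (x - ε • p) with hy
  have hyc : y ∈ convexHull ℝ (s : Set E) := by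
    refine mem_convexHull_iff_hbary.2 ⟨(1 - ε)⁻¹ • (w - ε • u), fun v => ?_, ?_, ?_⟩
    · refine mul_nonneg (inv_nonneg.2 (by linarith)) ?_
      have := h0 v
      simp only [Finsupp.sub_apply, Finsupp.smul_apply, smul_eq_mul, sub_nonneg] at this ⊢
      exact (mul_le_mul_of_nonneg_right (min_le_left _ _) (u0 v)).trans this
    · intro v hv
      by_contra hvs
      have h1 : w v = 0 := Finsupp.notMem_support_iff.1 (hw ▸ hvs)
      have h2 : u v = 0 := Finsupp.notMem_support_iff.1 fun h => hvs (hus h)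
      simp [h1, h2] at hv
    · rw [map_smul, map_sub, map_smul, hx, hup]
      ext
      · simp [hy]
      · simp only [Prod.smul_snd, Prod.snd_sub, smul_eq_mul, mul_one]
        exact inv_mul_cancel₀ (by linarith)
  have hxy : x = ε • p + (1 - ε) • y := by
    rw [hy, smul_inv_smul₀ (by linarith)]; abel
  clear_value y
  have hxc : x ∈ convexHull ℝ (s : Set E) := mem_convexHull_iff_hbary.2 ⟨w, w0, hw.le, hx⟩
  rw [mem_intrinsicInterior] at hp ⊢
  obtain ⟨p', hp', rfl⟩ := hp
  refine ⟨⟨x, subset_affineSpan ℝ _ hxc⟩, ?_, rfl⟩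
  rw [mem_interior_iff_mem_nhds] at hp' ⊢
  replace hp' := (preimage_coe_mem_nhds_subtype
    (s := (affineSpan ℝ (convexHull ℝ (s : Set E)) : Set E)) (a := p')).1 hp'
  refine (preimage_coe_mem_nhds_subtype
    (s := (affineSpan ℝ (convexHull ℝ (s : Set E)) : Set E))).2 ?_
  let ψ : E → E := fun q => AffineMap.lineMap y q ε⁻¹
  have hψ : Filter.Tendsto ψ (nhdsWithin x (affineSpan ℝ (convexHull ℝ (s : Set E))))
      (nhdsWithin p' (affineSpan ℝ (convexHull ℝ (s : Set E)))) := by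
    have hψx : ψ x = p' := by
      simp only [ψ, AffineMap.lineMap_apply_module]
      rw [hxy]
      match_scalars <;> field_simp; ring
    refine tendsto_nhdsWithin_iff.2 ⟨?_, ?_⟩
    · have : Continuous ψ := by
        simp only [ψ, AffineMap.lineMap_apply_module]; fun_prop
      exact hψx ▸ (this.tendsto x).mono_left nhdsWithin_le_nhds
    · filter_upwards [self_mem_nhdsWithin] with q hq
      exact AffineMap.lineMap_mem _ (subset_affineSpan ℝ _ hyc) hq
  filter_upwards [hψ hp'] with q hq
  have hq' : q = ε • ψ q + (1 - ε) • y := by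
    simp only [ψ, AffineMap.lineMap_apply_module]
    match_scalars <;> field_simp; ring
  rw [hq']
  exact (convex_convexHull ℝ _) hq hyc ε0.le (by linarith) (by ring)

/-- A choice, for every nonempty finite set of points, of positive weights of total weight one. -/
structure IsWeighting (β : Finset E → E →₀ ℝ) : Prop where
  nonneg : ∀ A v, 0 ≤ β A v
  support : ∀ A, (β A).support = A
  total : ∀ A : Finset E, A.Nonempty → (hbary (β A)).2 = 1

/-- The interior point determined by a weighting. -/
noncomputable def innerPoint (β : Finset E → E →₀ ℝ) (A : Finset E) : E := (hbary (β A)).1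

/-- The linear extension of a weighting. -/
noncomputable def expand (β : Finset E → E →₀ ℝ) : (Finset E →₀ ℝ) →ₗ[ℝ] (E →₀ ℝ) :=
  Finsupp.linearCombination ℝ β

omit [NormedAddCommGroup E] [NormedSpace ℝ E] in
lemma expand_apply (β : Finset E → E →₀ ℝ) (W : Finset E →₀ ℝ) (v : E) :
    expand β W v = ∑ A ∈ W.support, W A * β A v := by
  simp [expand, Finsupp.linearCombination_apply, Finsupp.sum, Finsupp.finsetSum_apply]

/-- A finite family of finite sets that is totally ordered by inclusion. -/
def IsFlag {α : Type*} (T : Finset (Finset α)) : Prop := ∀ A ∈ T, ∀ B ∈ T, A ⊆ B ∨ B ⊆ A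

lemma IsFlag.mono {α : Type*} {T T' : Finset (Finset α)} (h : IsFlag T) (hT : T' ⊆ T) :
    IsFlag T' := fun A hA B hB => h A (hT hA) B (hT hB)

lemma IsFlag.exists_top {α : Type*} {T : Finset (Finset α)} (h : IsFlag T) (hT : T.Nonempty) :
    ∃ A ∈ T, ∀ B ∈ T, B ⊆ A := by
  obtain ⟨A, hA, hmax⟩ := T.exists_max_image Finset.card hT
  refine ⟨A, hA, fun B hB => (h A hA B hB).elim (fun hAB => ?_) id⟩
  rw [Finset.eq_of_subset_of_card_le hAB (hmax B hB)]

namespace IsWeighting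

variable {β : Finset E → E →₀ ℝ} (hβ : IsWeighting β)
include hβ

lemma pos_iff (A : Finset E) (v : E) : 0 < β A v ↔ v ∈ A := by
  rw [← hβ.support A, Finsupp.mem_support_iff, hβ.support A]
  exact ⟨ne_of_gt, fun h => lt_of_le_of_ne (hβ.nonneg A v) h.symm⟩

lemma apply_eq_zero {A : Finset E} {v : E} (hv : v ∉ A) : β A v = 0 :=
  Finsupp.notMem_support_iff.1 (by rwa [hβ.support])

lemma hbary_eq {A : Finset E} (hA : A.Nonempty) : hbary (β A) = (innerPoint β A, 1) :=
  Prod.ext rfl (hβ.total A hA)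

lemma expand_nonneg {W : Finset E →₀ ℝ} (W0 : ∀ A, 0 ≤ W A) (v : E) : 0 ≤ expand β W v := by
  rw [expand_apply]
  exact Finset.sum_nonneg fun A _ => mul_nonneg (W0 A) (hβ.nonneg A v)

lemma le_expand {W : Finset E →₀ ℝ} (W0 : ∀ A, 0 ≤ W A) (A : Finset E) (v : E) :
    W A * β A v ≤ expand β W v := by
  rw [expand_apply]
  by_cases hA : A ∈ W.support
  · exact Finset.single_le_sum (f := fun A => W A * β A v)
      (fun A _ => mul_nonneg (W0 A) (hβ.nonneg A v)) hA
  · rw [Finsupp.notMem_support_iff.1 hA, zero_mul]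
    exact Finset.sum_nonneg fun A _ => mul_nonneg (W0 A) (hβ.nonneg A v)

lemma support_expand_subset {W : Finset E →₀ ℝ} {A : Finset E} (h : ∀ B ∈ W.support, B ⊆ A) :
    (expand β W).support ⊆ A := by
  intro v hv
  by_contra hvA
  refine Finsupp.mem_support_iff.1 hv ?_
  rw [expand_apply]
  exact Finset.sum_eq_zero fun B hB => by rw [hβ.apply_eq_zero fun h' => hvA (h B hB h'), mul_zero]

lemma support_expand {W : Finset E →₀ ℝ} (W0 : ∀ A, 0 ≤ W A) {A : Finset E} (hA : A ∈ W.support)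
    (h : ∀ B ∈ W.support, B ⊆ A) : (expand β W).support = A := by
  refine (hβ.support_expand_subset h).antisymm fun v hv => ?_
  rw [Finsupp.mem_support_iff]
  have := hβ.le_expand W0 A v
  have h1 : 0 < W A := lt_of_le_of_ne (W0 A) (Ne.symm (Finsupp.mem_support_iff.1 hA))
  exact ((mul_pos h1 ((hβ.pos_iff A v).2 hv)).trans_le this).ne'

lemma expand_injective_aux (m : ℕ) : ∀ {W W' : Finset E →₀ ℝ}, W.support.card = m →
    (∀ A, 0 ≤ W A) → (∀ A, 0 ≤ W' A) → IsFlag W.support → IsFlag W'.support →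
    W ∅ = 0 → W' ∅ = 0 → expand β W = expand β W' → W = W' := by
  have zero : ∀ {W : Finset E →₀ ℝ}, (∀ A, 0 ≤ W A) → IsFlag W.support → W ∅ = 0 →
      expand β W = 0 → W = 0 := by
    intro W W0 hW he h
    by_contra hne
    obtain ⟨A, hA, htop⟩ := hW.exists_top (Finsupp.support_nonempty_iff.2 hne)
    have := hβ.support_expand W0 hA htop
    rw [h, Finsupp.support_zero] at this
    exact Finsupp.mem_support_iff.1 hA (this ▸ he)
  have le : ∀ {W W' : Finset E →₀ ℝ} {A : Finset E}, (∀ A, 0 ≤ W A) → (∀ A, 0 ≤ W' A) →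
      IsFlag W.support → A ∈ W.support → (∀ B ∈ W.support, B ⊆ A) → A.Nonempty →
      expand β W = expand β W' → W' A ≤ W A := by
    intro W W' A W0 W0' hW hA htop hne h
    obtain ⟨v, hv, hv'⟩ : ∃ v ∈ A, ∀ B ∈ W.support, B ≠ A → v ∉ B := by
      by_cases hN : (W.support.erase A).Nonempty
      · obtain ⟨B, hB, hBtop⟩ := (hW.mono (Finset.erase_subset A _)).exists_top hN
        rw [Finset.mem_erase] at hB
        obtain ⟨v, hv, hvB⟩ := Finset.exists_of_ssubset ((htop B hB.2).ssubset_of_ne hB.1)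
        exact ⟨v, hv, fun C hC hCA hvC => hvB (hBtop C (Finset.mem_erase.2 ⟨hCA, hC⟩) hvC)⟩
      · obtain ⟨v, hv⟩ := hne
        exact ⟨v, hv, fun B hB hBA => (hN ⟨B, Finset.mem_erase.2 ⟨hBA, hB⟩⟩).elim⟩
    have e : expand β W v = W A * β A v := by
      rw [expand_apply]
      exact Finset.sum_eq_single A
        (fun B hB hBA => by rw [hβ.apply_eq_zero (hv' B hB hBA), mul_zero]) (fun h' => (h' hA).elim)
    have := hβ.le_expand W0' A v
    rw [← h, e] at this
    exact le_of_mul_le_mul_right this ((hβ.pos_iff A v).2 hv)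
  induction m with
  | zero =>
    intro W W' hm W0 W0' hW hW' he he' h
    have hz : W = 0 := by simpa using hm
    rw [hz, map_zero] at h
    rw [hz, zero W0' hW' he' h.symm]
  | succ m ih =>
    intro W W' hm W0 W0' hW hW' he he' h
    have hne : W ≠ 0 := by rintro rfl; simp at hm
    have hne' : W' ≠ 0 := by rintro rfl; exact hne (zero W0 hW he (by simpa using h))
    obtain ⟨A, hA, htop⟩ := hW.exists_top (Finsupp.support_nonempty_iff.2 hne)
    obtain ⟨A', hA', htop'⟩ := hW'.exists_top (Finsupp.support_nonempty_iff.2 hne')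
    obtain rfl : A = A' := by
      rw [← hβ.support_expand W0 hA htop, h, hβ.support_expand W0' hA' htop']
    have hAne : A.Nonempty := by
      rw [Finset.nonempty_iff_ne_empty]
      rintro rfl
      exact Finsupp.mem_support_iff.1 hA he
    have hc : W A = W' A := le_antisymm (le W0' W0 hW' hA' htop' hAne h.symm)
      (le W0 W0' hW hA htop hAne h)
    have er : ∀ {V : Finset E →₀ ℝ}, (∀ A, 0 ≤ V A) → ∀ B, 0 ≤ V.erase A B := fun hV B => by
      by_cases hBA : B = A
      · simp [hBA]
      · simpa [Finsupp.erase_ne hBA] using hV B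
    have hz : ∀ {V : Finset E →₀ ℝ}, V ∅ = 0 → V.erase A ∅ = 0 := fun hV => by
      by_cases hBA : ∅ = A
      · simp [← hBA]
      · rw [Finsupp.erase_ne hBA, hV]
    have := ih (W := W.erase A) (W' := W'.erase A)
      (by rw [Finsupp.support_erase, Finset.card_erase_of_mem hA, hm]; rfl) (er W0) (er W0')
      (hW.mono (by rw [Finsupp.support_erase]; exact Finset.erase_subset _ _))
      (hW'.mono (by rw [Finsupp.support_erase]; exact Finset.erase_subset _ _))
      (hz he) (hz he')
      (by rw [Finsupp.erase_eq_sub_single, Finsupp.erase_eq_sub_single, map_sub, map_sub, h, hc])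
    rw [← Finsupp.single_add_erase A W, ← Finsupp.single_add_erase A W', this, hc]

lemma expand_injective {W W' : Finset E →₀ ℝ} (W0 : ∀ A, 0 ≤ W A) (W0' : ∀ A, 0 ≤ W' A)
    (hW : IsFlag W.support) (hW' : IsFlag W'.support) (he : W ∅ = 0) (he' : W' ∅ = 0)
    (h : expand β W = expand β W') : W = W' :=
  hβ.expand_injective_aux _ rfl W0 W0' hW hW' he he' h

lemma exists_expand_eq (m : ℕ) : ∀ {y : E →₀ ℝ}, y.support.card = m → (∀ v, 0 ≤ y v) →
    ∃ W : Finset E →₀ ℝ, (∀ A, 0 ≤ W A) ∧ IsFlag W.support ∧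
      (∀ A ∈ W.support, A.Nonempty ∧ A ⊆ y.support) ∧ expand β W = y := by
  induction m using Nat.strong_induction_on with
  | _ m ih =>
    intro y hm y0
    by_cases hy : y = 0
    · exact ⟨0, by simp, by simp [IsFlag], by simp, by simp [hy]⟩
    have hne := Finsupp.support_nonempty_iff.2 hy
    obtain ⟨t, ht, h0, a, ha, hz⟩ := exists_slide (ρ := β y.support) hne y0
      (hβ.pos_iff _) (fun v hv => lt_of_le_of_ne (y0 v) (Ne.symm (Finsupp.mem_support_iff.1 hv)))
    have hsub : (y - t • β y.support).support ⊂ y.support := by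
      refine ⟨fun v hv => ?_, fun h => Finsupp.mem_support_iff.1 (h ha) hz⟩
      by_contra hvy
      refine Finsupp.mem_support_iff.1 hv ?_
      simp [hβ.apply_eq_zero hvy, Finsupp.notMem_support_iff.1 hvy]
    obtain ⟨W, W0, hW, hWs, hWy⟩ := ih _ (hm ▸ Finset.card_lt_card hsub) rfl h0
    have hnot : y.support ∉ W.support := fun h => hsub.2 (hWs _ h).2
    have hsupp : ∀ B ∈ (W + Finsupp.single y.support t).support,
        B ∈ W.support ∨ B = y.support := fun B hB => by
      simpa using (Finset.mem_union.1 (Finsupp.support_add hB)).imp id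
        (fun h => Finset.mem_singleton.1 (Finsupp.support_single_subset h))
    refine ⟨W + Finsupp.single y.support t, fun A => ?_, ?_, ?_, ?_⟩
    · rw [Finsupp.add_apply, Finsupp.single_apply]
      split_ifs
      · exact add_nonneg (W0 A) ht.le
      · simpa using W0 A
    · intro A hA B hB
      rcases hsupp A hA with hA | rfl <;> rcases hsupp B hB with hB | rfl
      · exact hW A hA B hB
      · exact .inl ((hWs A hA).2.trans hsub.1)
      · exact .inr ((hWs B hB).2.trans hsub.1)
      · exact .inl subset_rfl
    · intro A hA
      rcases hsupp A hA with hA | rfl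
      · exact ⟨(hWs A hA).1, (hWs A hA).2.trans hsub.1⟩
      · exact ⟨hne, subset_rfl⟩
    · rw [map_add, hWy, expand, Finsupp.linearCombination_single, sub_add_cancel]

lemma hbary_mapDomain {W : Finset E →₀ ℝ} (he : W ∅ = 0) :
    hbary (W.mapDomain (innerPoint β)) = hbary (expand β W) := by
  rw [expand, Finsupp.linearCombination_apply, Finsupp.mapDomain, Finsupp.sum, Finsupp.sum,
    map_sum, map_sum]
  refine Finset.sum_congr rfl fun A hA => ?_
  have hne : A.Nonempty := by
    rw [Finset.nonempty_iff_ne_empty]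
    rintro rfl
    exact Finsupp.mem_support_iff.1 hA he
  rw [hbary_single, map_smul, hβ.hbary_eq hne]
  simp

end IsWeighting

lemma mapDomain_nonneg {α α' : Type*} (f : α → α') {W : α →₀ ℝ} (W0 : ∀ a, 0 ≤ W a) (y : α') :
    0 ≤ W.mapDomain f y := by
  rw [Finsupp.mapDomain, Finsupp.sum, Finsupp.finsetSum_apply]
  refine Finset.sum_nonneg fun a _ => ?_
  rw [Finsupp.single_apply]
  split_ifs
  exacts [W0 a, le_rfl]

lemma mapDomain_indicator {α α' : Type*} {f : α → α'} {T : Finset α} (hf : Set.InjOn f T)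
    {w : α' →₀ ℝ} (hw : w.support ⊆ T.image f) :
    (Finsupp.indicator T fun a _ => w (f a)).mapDomain f = w := by
  ext y
  by_cases hy : y ∈ T.image f
  · obtain ⟨a, ha, rfl⟩ := Finset.mem_image.1 hy
    rw [Finsupp.mapDomain_apply' T _ (Finset.coe_subset.2 (support_indicator_subset' T _)) hf ha,
      indicator_apply_mem (fun a => w (f a)) ha]
  · rw [Finsupp.notMem_support_iff.1 fun h => hy (hw h), ← Finsupp.notMem_support_iff]
    exact fun h => hy (Finset.image_subset_image (support_indicator_subset' T _)
      (Finsupp.mapDomain_support h))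

lemma indicator_nonneg {α : Type*} {T : Finset α} {f : α → ℝ} (hf : ∀ a, 0 ≤ f a) (a : α) :
    0 ≤ (Finsupp.indicator T fun a _ => f a) a := by
  by_cases ha : a ∈ T <;> simp [Finsupp.indicator, ha, hf]

/-- The simplices of the derived subdivision determined by a weighting. -/
def derivedFaces (K : Geometry.SimplicialComplex ℝ E) (β : Finset E → E →₀ ℝ) : Set (Finset E) :=
  {S | ∃ T : Finset (Finset E), ↑T ⊆ K.faces ∧ T.Nonempty ∧ IsFlag T ∧ S = T.image (innerPoint β)}

namespace IsWeighting

variable {β : Finset E → E →₀ ℝ} (hβ : IsWeighting β) {K : Geometry.SimplicialComplex ℝ E}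
include hβ

lemma innerPoint_injOn : Set.InjOn (innerPoint β) K.faces := by
  intro A hA B hB h
  rw [← hβ.support A, ← hβ.support B, K.eq_of_hbary_eq (hβ.nonneg A) (hβ.nonneg B) hA
    (hβ.support A).le hB (hβ.support B).le]
  rw [hβ.hbary_eq (K.nonempty_of_mem_faces hA), hβ.hbary_eq (K.nonempty_of_mem_faces hB), h]

lemma exists_lift {T : Finset (Finset E)} (hT : ↑T ⊆ K.faces) {w : E →₀ ℝ}
    (hw : w.support ⊆ T.image (innerPoint β)) :
    ∃ W : Finset E →₀ ℝ, W.support ⊆ T ∧ W.mapDomain (innerPoint β) = w ∧ W ∅ = 0 ∧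
      ((∀ v, 0 ≤ w v) → ∀ A, 0 ≤ W A) ∧ (∀ A ∈ T, W A = w (innerPoint β A)) ∧
      hbary (expand β W) = hbary w := by
  have h1 := support_indicator_subset' T fun A => w (innerPoint β A)
  have h2 := mapDomain_indicator ((hβ.innerPoint_injOn (K := K)).mono hT) hw
  have h3 : (Finsupp.indicator T fun A _ => w (innerPoint β A)) ∅ = 0 :=
    Finsupp.notMem_support_iff.1 fun h => K.empty_notMem (hT (h1 h))
  exact ⟨_, h1, h2, h3, fun w0 => indicator_nonneg fun A => w0 _,
    fun A hA => indicator_apply_mem (fun A => w (innerPoint β A)) hA, by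
    rw [← hβ.hbary_mapDomain h3, h2]⟩

lemma isGeometric_derivedFaces : IsGeometric (derivedFaces K β) := by
  rintro w u w0 u0 ⟨T, hT, hTne, hTf, hw⟩ ⟨T', hT', hTne', hTf', hu⟩ h
  obtain ⟨W, hW, rfl, hWe, W0, -, hWh⟩ := hβ.exists_lift hT hw.le
  obtain ⟨U, hU, rfl, hUe, U0, -, hUh⟩ := hβ.exists_lift hT' hu.le
  obtain ⟨A, hA, hAtop⟩ := hTf.exists_top hTne
  obtain ⟨B, hB, hBtop⟩ := hTf'.exists_top hTne'
  rw [hβ.expand_injective (W0 w0) (U0 u0) (hTf.mono hW) (hTf'.mono hU) hWe hUe]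
  exact K.eq_of_hbary_eq (hβ.expand_nonneg (W0 w0)) (hβ.expand_nonneg (U0 u0)) (hT hA)
    (hβ.support_expand_subset fun C hC => hAtop C (hW hC)) (hT' hB)
    (hβ.support_expand_subset fun C hC => hBtop C (hU hC)) (by rw [hWh, hUh, h])

variable (K)

/-- The derived subdivision determined by a weighting. -/
def derived : Geometry.SimplicialComplex ℝ E :=
  .ofIsGeometric (derivedFaces K β)
    (by
      rintro s ⟨T, -, hT, -, rfl⟩
      exact hT.image _)
    (by
      rintro s ⟨T, hTK, hT, hTf, rfl⟩ t ht hne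
      refine ⟨T.filter fun A => innerPoint β A ∈ t, fun A hA => hTK (Finset.filter_subset _ _ hA),
        ?_, hTf.mono (Finset.filter_subset _ _), ?_⟩
      · obtain ⟨v, hv⟩ := hne
        obtain ⟨A, hA, rfl⟩ := Finset.mem_image.1 (ht hv)
        exact ⟨A, Finset.mem_filter.2 ⟨hA, hv⟩⟩
      · ext v
        simp only [Finset.mem_image, Finset.mem_filter]
        constructor
        · intro hv
          obtain ⟨A, hA, rfl⟩ := Finset.mem_image.1 (ht hv)
          exact ⟨A, ⟨hA, hv⟩, rfl⟩
        · rintro ⟨A, ⟨-, h⟩, rfl⟩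
          exact h)
    hβ.isGeometric_derivedFaces

variable {K}

lemma convexHull_image_subset {T : Finset (Finset E)} (hT : ↑T ⊆ K.faces) {A : Finset E}
    (hA : ∀ B ∈ T, B ⊆ A) :
    convexHull ℝ ((T.image (innerPoint β) : Finset E) : Set E) ⊆ convexHull ℝ (A : Set E) := by
  intro x hx
  obtain ⟨w, w0, hw, hwx⟩ := mem_convexHull_iff_hbary.1 hx
  obtain ⟨W, hW, rfl, -, W0, -, hWh⟩ := hβ.exists_lift hT hw
  exact mem_convexHull_iff_hbary.2 ⟨_, hβ.expand_nonneg (W0 w0),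
    hβ.support_expand_subset fun C hC => hA C (hW hC), hWh.trans hwx⟩

variable (K)

lemma space_derived : (hβ.derived K).space = K.space := by
  ext x
  constructor
  · rw [Geometry.SimplicialComplex.mem_space_iff]
    rintro ⟨s, ⟨T, hT, hTne, hTf, rfl⟩, hx⟩
    obtain ⟨A, hA, htop⟩ := hTf.exists_top hTne
    exact Geometry.SimplicialComplex.mem_space_iff.2
      ⟨A, hT hA, hβ.convexHull_image_subset hT htop hx⟩
  · rw [Geometry.SimplicialComplex.mem_space_iff_hbary]
    rintro ⟨y, y0, hy, hyx⟩
    obtain ⟨W, W0, hW, hWs, rfl⟩ := hβ.exists_expand_eq _ rfl y0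
    have hWe : W ∅ = 0 := Finsupp.notMem_support_iff.1 fun h => by simpa using (hWs _ h).1
    have hne : W.support.Nonempty := by
      rw [Finsupp.support_nonempty_iff]
      rintro rfl
      exact ne_zero_of_hbary_eq hyx (map_zero _)
    refine Geometry.SimplicialComplex.mem_space_iff.2 ⟨W.support.image (innerPoint β),
      ⟨W.support, fun A hA => K.down_closed hy (hWs A hA).2 (hWs A hA).1, hne, hW, rfl⟩,
      mem_convexHull_iff_hbary.2 ⟨W.mapDomain (innerPoint β), mapDomain_nonneg _ W0,
        Finsupp.mapDomain_support, ?_⟩⟩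
    rw [hβ.hbary_mapDomain hWe, hyx]

lemma isDerivedSubdivision [FiniteDimensional ℝ E] : IsDerivedSubdivision (hβ.derived K) K :=
  ⟨innerPoint β, fun A hA => mem_intrinsicInterior_of_hbary (hβ.nonneg A) (hβ.support A)
    (hβ.hbary_eq (K.nonempty_of_mem_faces hA)), rfl⟩

lemma finite_derived (hK : K.faces.Finite) : (hβ.derived K).faces.Finite := by
  refine (hK.toFinset.powerset.image fun T => T.image (innerPoint β)).finite_toSet.subset ?_
  rintro s ⟨T, hT, -, -, rfl⟩
  simp only [Finset.coe_image, Set.mem_image, Finset.mem_coe, Finset.mem_powerset]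
  exact ⟨T, fun A hA => hK.mem_toFinset.2 (hT hA), rfl⟩

end IsWeighting

/-! ### One-sided faces -/

lemma map_hbary (f : E × ℝ →ₗ[ℝ] ℝ) {w : E →₀ ℝ} {s : Finset E} (h : w.support ⊆ s) :
    f (hbary w) = ∑ v ∈ s, w v * f (v, 1) := by
  rw [hbary, Finsupp.linearCombination_apply, Finsupp.sum_of_support_subset w h _ (by simp),
    map_sum]
  exact Finset.sum_congr rfl fun v _ => by rw [map_smul, smul_eq_mul]

/-- A finite set of points lies in one of the closed half-spaces bounded by the zero set of `f`. -/
def OneSided (f : E × ℝ →ₗ[ℝ] ℝ) (A : Finset E) : Prop :=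
  (∀ v ∈ A, 0 ≤ f (v, 1)) ∨ ∀ v ∈ A, f (v, 1) ≤ 0

lemma exists_weights_of_not_oneSided {f : E × ℝ →ₗ[ℝ] ℝ} {A : Finset E} (h : ¬ OneSided f A) :
    ∃ w : E →₀ ℝ, (∀ v, 0 ≤ w v) ∧ w.support = A ∧ f (hbary w) = 0 := by
  simp only [OneSided, not_or, not_forall, not_le] at h
  obtain ⟨⟨a, ha, hfa⟩, b, hb, hfb⟩ := h
  set u : E →₀ ℝ := Finsupp.indicator A fun _ _ => 1 with hu
  have u1 : ∀ v ∈ A, u v = 1 := fun v hv => indicator_apply_mem (fun _ => 1) hv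
  have u0 : ∀ v, 0 ≤ u v := indicator_nonneg fun _ => zero_le_one
  have key : ∀ c ∈ A, ∀ t ≥ (0 : ℝ), f (hbary u) + t * f (c, 1) = 0 →
      ∃ w : E →₀ ℝ, (∀ v, 0 ≤ w v) ∧ w.support = A ∧ f (hbary w) = 0 := by
    intro c hc t ht h0
    have hs : ∀ v, 0 ≤ (Finsupp.single c t : E →₀ ℝ) v := fun v => by
      rw [Finsupp.single_apply]; split_ifs; exacts [ht, le_rfl]
    refine ⟨u + Finsupp.single c t, fun v => add_nonneg (u0 v) (hs v), ?_, ?_⟩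
    · ext v
      rw [Finsupp.mem_support_iff, Finsupp.add_apply]
      constructor
      · intro hv
        by_contra hvA
        refine hv ?_
        rw [Finsupp.notMem_support_iff.1 fun h => hvA (support_indicator_subset' A _ h),
          Finsupp.single_eq_of_ne (by rintro rfl; exact hvA hc), add_zero]
      · intro hv
        have := hs v
        rw [u1 v hv]
        positivity
    · have : ((t • c, t) : E × ℝ) = t • (c, 1) := by simp
      rw [map_add, map_add, hbary_single, this, map_smul, smul_eq_mul, h0]
  rcases le_total 0 (f (hbary u)) with h | h
  · refine key a ha (f (hbary u) / -f (a, 1)) (div_nonneg h (by linarith)) ?_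
    have := hfa.ne
    field_simp
    ring
  · refine key b hb (-f (hbary u) / f (b, 1)) (div_nonneg (by linarith) hfb.le) ?_
    field_simp
    ring

/-- There is a weighting whose interior points lie on the zero set of `f` whenever possible. -/
lemma exists_adapted_weighting (f : E × ℝ →ₗ[ℝ] ℝ) :
    ∃ β : Finset E → E →₀ ℝ, IsWeighting β ∧ ∀ A, ¬ OneSided f A → f (hbary (β A)) = 0 := by
  have key : ∀ A : Finset E, ∃ w : E →₀ ℝ, (∀ v, 0 ≤ w v) ∧ w.support = A ∧
      (A.Nonempty → (hbary w).2 = 1) ∧ (¬ OneSided f A → f (hbary w) = 0) := by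
    intro A
    obtain ⟨w, w0, hw, hf⟩ : ∃ w : E →₀ ℝ, (∀ v, 0 ≤ w v) ∧ w.support = A ∧
        (¬ OneSided f A → f (hbary w) = 0) := by
      by_cases h : OneSided f A
      · refine ⟨Finsupp.indicator A fun _ _ => 1, indicator_nonneg fun _ => zero_le_one,
          (support_indicator_subset' A _).antisymm fun v hv => ?_, fun h' => (h' h).elim⟩
        rw [Finsupp.mem_support_iff, indicator_apply_mem (fun _ => 1) hv]
        exact one_ne_zero
      · obtain ⟨w, w0, hw, hf⟩ := exists_weights_of_not_oneSided h
        exact ⟨w, w0, hw, fun _ => hf⟩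
    by_cases hA : A.Nonempty
    · have hpos := hbary_snd_pos w0 (Finsupp.support_nonempty_iff.1 (hw ▸ hA))
      refine ⟨(hbary w).2⁻¹ • w, fun v => ?_, ?_, fun _ => ?_, fun h => ?_⟩
      · simpa using mul_nonneg (inv_nonneg.2 hpos.le) (w0 v)
      · rw [Finsupp.support_smul_eq (inv_ne_zero hpos.ne'), hw]
      · rw [map_smul, Prod.smul_snd, smul_eq_mul, inv_mul_cancel₀ hpos.ne']
      · rw [map_smul, map_smul, hf h, smul_zero]
    · exact ⟨w, w0, hw, fun h => (hA h).elim, hf⟩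
  choose β h using key
  exact ⟨β, ⟨fun A => (h A).1, fun A => (h A).2.1, fun A => (h A).2.2.1⟩, fun A => (h A).2.2.2⟩

namespace IsWeighting

variable {β : Finset E → E →₀ ℝ} (hβ : IsWeighting β) {K : Geometry.SimplicialComplex ℝ E}
include hβ

lemma map_innerPoint_nonneg {f : E × ℝ →ₗ[ℝ] ℝ} {A : Finset E} (hA : A.Nonempty)
    (h : ∀ v ∈ A, 0 ≤ f (v, 1)) : 0 ≤ f (innerPoint β A, 1) := by
  rw [← hβ.hbary_eq hA, map_hbary f (hβ.support A).le]
  exact Finset.sum_nonneg fun v hv => mul_nonneg (hβ.nonneg A v) (h v hv)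

lemma map_innerPoint_nonpos {f : E × ℝ →ₗ[ℝ] ℝ} {A : Finset E} (hA : A.Nonempty)
    (h : ∀ v ∈ A, f (v, 1) ≤ 0) : f (innerPoint β A, 1) ≤ 0 := by
  have := hβ.map_innerPoint_nonneg (f := -f) hA (by simpa using h)
  simpa using this

lemma oneSided_derived_of_forall {f : E × ℝ →ₗ[ℝ] ℝ} (hf : ∀ A ∈ K.faces, OneSided f A) :
    ∀ S ∈ (hβ.derived K).faces, OneSided f S := by
  rintro S ⟨T, hT, hTne, hTf, rfl⟩
  obtain ⟨A, hA, htop⟩ := hTf.exists_top hTne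
  refine (hf A (hT hA)).imp (fun h => ?_) (fun h => ?_) <;>
    refine Finset.forall_mem_image.2 fun B hB => ?_
  · exact hβ.map_innerPoint_nonneg (K.nonempty_of_mem_faces (hT hB)) fun v hv => h v (htop B hB hv)
  · exact hβ.map_innerPoint_nonpos (K.nonempty_of_mem_faces (hT hB)) fun v hv => h v (htop B hB hv)

lemma oneSided_derived_of_adapted {f : E × ℝ →ₗ[ℝ] ℝ}
    (hf : ∀ A, ¬ OneSided f A → f (hbary (β A)) = 0) :
    ∀ S ∈ (hβ.derived K).faces, OneSided f S := by
  rintro S ⟨T, hT, hTne, hTf, rfl⟩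
  by_contra hS
  simp only [OneSided, not_or, not_forall, not_le, Finset.mem_image] at hS
  obtain ⟨⟨_, ⟨A, hA, rfl⟩, hfA⟩, _, ⟨B, hB, rfl⟩, hfB⟩ := hS
  have hAne := K.nonempty_of_mem_faces (hT hA)
  have hBne := K.nonempty_of_mem_faces (hT hB)
  rcases hTf A hA B hB with h | h
  · by_cases hs : OneSided f B
    · rcases hs with hs | hs
      · exact hfA.not_ge (hβ.map_innerPoint_nonneg hAne fun v hv => hs v (h hv))
      · exact hfB.not_ge (hβ.map_innerPoint_nonpos hBne hs)
    · have := hf B hs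
      rw [hβ.hbary_eq hBne] at this
      exact hfB.ne' this
  · by_cases hs : OneSided f A
    · rcases hs with hs | hs
      · exact hfA.not_ge (hβ.map_innerPoint_nonneg hAne hs)
      · exact hfB.not_ge (hβ.map_innerPoint_nonpos hBne fun v hv => hs v (h hv))
    · have := hf A hs
      rw [hβ.hbary_eq hAne] at this
      exact hfA.ne this

end IsWeighting

/-! ### Boundary faces -/

namespace Geometry.SimplicialComplex

variable {K : Geometry.SimplicialComplex ℝ E}

lemma convexHull_subset_space' {s : Finset E} (hs : s ∈ K.faces) :
    convexHull ℝ (s : Set E) ⊆ K.space := fun _ hx => mem_space_iff.2 ⟨s, hs, hx⟩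

/-- Near a point in the interior of a face `A`, every point of the complex lies in a face
containing `A`. -/
lemma eventually_exists_superset (hK : K.faces.Finite) {w : E →₀ ℝ} (w0 : ∀ v, 0 ≤ w v)
    (hw : w.support ∈ K.faces) {y : E} (hy : hbary w = (y, 1)) :
    ∀ᶠ y' in nhds y, y' ∈ K.space → ∃ G ∈ K.faces, w.support ⊆ G ∧
      y' ∈ convexHull ℝ (G : Set E) := by
  have hcl : IsClosed (⋃ G ∈ {G ∈ K.faces | ¬ w.support ⊆ G}, convexHull ℝ (G : Set E)) :=
    (hK.subset fun G hG => hG.1).isClosed_biUnion fun G _ =>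
      (G.finite_toSet.isCompact_convexHull (𝕜 := ℝ)).isClosed
  have hmem : y ∉ ⋃ G ∈ {G ∈ K.faces | ¬ w.support ⊆ G}, convexHull ℝ (G : Set E) := by
    simp only [Set.mem_iUnion, not_exists]
    rintro G ⟨hG, hGw⟩ hyG
    obtain ⟨u, u0, hu, huy⟩ := mem_convexHull_iff_hbary.1 hyG
    rw [K.eq_of_hbary_eq w0 u0 hw subset_rfl hG hu (hy.trans huy.symm)] at hGw
    exact hGw hu
  filter_upwards [hcl.isOpen_compl.mem_nhds hmem] with y' hy' hK'
  obtain ⟨G, hG, hyG⟩ := mem_space_iff.1 hK'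
  refine ⟨G, hG, ?_, hyG⟩
  by_contra h
  exact hy' (Set.mem_biUnion (show G ∈ {G ∈ K.faces | ¬ w.support ⊆ G} from ⟨hG, h⟩) hyG)

end Geometry.SimplicialComplex

namespace Geometry.SimplicialComplex

variable {K : Geometry.SimplicialComplex ℝ E}

lemma hbary_add_smul_sub {w u g : E →₀ ℝ} {x z x' z' : E} {t : ℝ} (hw : hbary w = (x, 1))
    (hu : hbary u = (z, 1)) (hg : hbary g = (z', 1)) (hx' : x' = x + t • (z' - z)) :
    hbary (t • g + (w - t • u)) = (x', 1) := by
  rw [map_add, map_sub, map_smul, map_smul, hw, hu, hg, hx']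
  ext
  · simp only [Prod.fst_add, Prod.fst_sub, Prod.smul_fst]
    module
  · simp

/-- If a point in the interior of a face lies on the frontier, so does the whole face. -/
lemma convexHull_subset_frontier (hK : K.faces.Finite) {w : E →₀ ℝ} (w0 : ∀ v, 0 ≤ w v)
    (hw : w.support ∈ K.faces) {x : E} (hx : hbary w = (x, 1)) (hxf : x ∈ frontier K.space) :
    convexHull ℝ (w.support : Set E) ⊆ frontier K.space := by
  intro z hz
  refine ⟨subset_closure (convexHull_subset_space' hw hz), fun hzi => hxf.2 ?_⟩
  obtain ⟨u, u0, hu, huz⟩ := mem_convexHull_iff_hbary.1 hz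
  have hc : Continuous fun ε : ℝ => z + ε • (x - z) := by fun_prop
  have hnear : ∀ᶠ ε in nhds (0 : ℝ), z + ε • (x - z) ∈ interior K.space :=
    hc.continuousAt.eventually (isOpen_interior.mem_nhds (by simpa using hzi))
  obtain ⟨ε, hε, ε0, ε1⟩ : ∃ ε : ℝ, z + ε • (x - z) ∈ interior K.space ∧ 0 < ε ∧ ε < 1 := by
    obtain ⟨ε, h1, h2⟩ := ((hnear.filter_mono nhdsWithin_le_nhds).and
      (Ioo_mem_nhdsGT (zero_lt_one' ℝ))).exists
    exact ⟨ε, h1, h2.1, h2.2⟩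
  set u' : E →₀ ℝ := ε • w + (u - ε • u) with hu'
  have hu'z : hbary u' = (z + ε • (x - z), 1) := hbary_add_smul_sub huz huz hx rfl
  have hu'v : ∀ v, u' v = ε * w v + (1 - ε) * u v := fun v => by
    simp only [hu', Finsupp.add_apply, Finsupp.sub_apply, Finsupp.smul_apply, smul_eq_mul]; ring
  have u'pos : ∀ v, 0 < u' v ↔ v ∈ w.support := by
    intro v
    rw [hu'v, Finsupp.mem_support_iff]
    constructor
    · intro h h0
      rw [h0, Finsupp.notMem_support_iff.1 fun h => Finsupp.mem_support_iff.1 (hu h) h0] at h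
      simp at h
    · intro h
      have h1 := mul_pos ε0 (lt_of_le_of_ne (w0 v) h.symm)
      have h2 := mul_nonneg (sub_nonneg.2 ε1.le) (u0 v)
      linarith
  have u'0 : ∀ v, 0 ≤ u' v := fun v => by
    rw [hu'v]
    exact add_nonneg (mul_nonneg ε0.le (w0 v)) (mul_nonneg (sub_nonneg.2 ε1.le) (u0 v))
  have hu's : u'.support = w.support := by
    ext v
    rw [← u'pos, Finsupp.mem_support_iff]
    exact ⟨fun h => lt_of_le_of_ne (u'0 v) h.symm, ne_of_gt⟩
  obtain ⟨t, ht, hts, -⟩ := exists_slide (K.nonempty_of_mem_faces hw) w0 u'pos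
    (fun v hv => lt_of_le_of_ne (w0 v) (Ne.symm (Finsupp.mem_support_iff.1 hv)))
  have hev := eventually_exists_superset hK u'0 (hu's ▸ hw) hu'z
  have hev' := hev.and (isOpen_interior.mem_nhds hε)
  have hc' : Filter.Tendsto (fun x' => z + ε • (x - z) + t⁻¹ • (x' - x)) (nhds x)
      (nhds (z + ε • (x - z))) := by
    have : Continuous fun x' => z + ε • (x - z) + t⁻¹ • (x' - x) := by fun_prop
    simpa using this.tendsto x
  rw [mem_interior_iff_mem_nhds]
  filter_upwards [hc'.eventually hev'] with x' hx'
  obtain ⟨G, hG, hwG, hzG⟩ := hx'.1 (interior_subset hx'.2)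
  obtain ⟨g, g0, hg, hgz⟩ := mem_convexHull_iff_hbary.1 hzG
  refine mem_space_iff.2 ⟨G, hG, mem_convexHull_iff_hbary.2 ⟨t • g + (w - t • u'), fun v => ?_, ?_,
    hbary_add_smul_sub hx hu'z hgz ?_⟩⟩
  · exact add_nonneg (by simpa using mul_nonneg ht.le (g0 v)) (hts v)
  · refine Finsupp.support_add.trans (Finset.union_subset (Finsupp.support_smul.trans hg) ?_)
    refine Finsupp.support_sub.trans (Finset.union_subset (by rwa [hu's] at hwG) ?_)
    exact Finsupp.support_smul.trans hwG
  · rw [add_sub_cancel_left, smul_inv_smul₀ ht.ne']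
    abel

/-- The faces contained in the frontier of the support. -/
def boundaryFaces (K : Geometry.SimplicialComplex ℝ E) : Set (Finset E) :=
  {s ∈ K.faces | convexHull ℝ (s : Set E) ⊆ frontier K.space}

end Geometry.SimplicialComplex

lemma IsWeighting.boundaryFaces_derived_subset {β : Finset E → E →₀ ℝ} (hβ : IsWeighting β)
    {K₁ K₂ : Geometry.SimplicialComplex ℝ E} (hK₁ : K₁.faces.Finite) (h : K₁.space = K₂.space)
    (hbd : K₁.boundaryFaces ⊆ K₂.boundaryFaces) :
    (hβ.derived K₁).boundaryFaces ⊆ (hβ.derived K₂).boundaryFaces := by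
  rintro S ⟨⟨T, hT, hTne, hTf, rfl⟩, hS⟩
  rw [hβ.space_derived] at hS
  refine ⟨⟨T, fun A hA => (hbd ⟨hT hA, ?_⟩).1, hTne, hTf, rfl⟩, by rwa [hβ.space_derived, ← h]⟩
  have hb : innerPoint β A ∈ frontier K₁.space :=
    hS (subset_convexHull ℝ _ (Finset.mem_coe.2 (Finset.mem_image_of_mem _ hA)))
  have := K₁.convexHull_subset_frontier hK₁ (hβ.nonneg A) (by rw [hβ.support]; exact hT hA)
    (hβ.hbary_eq (K₁.nonempty_of_mem_faces (hT hA))) hb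
  rwa [hβ.support] at this

/-- `L` is obtained from `K` by iterating derived subdivisions given by weightings. -/
inductive DerivedChain (K : Geometry.SimplicialComplex ℝ E) :
    Geometry.SimplicialComplex ℝ E → Prop
  | refl : DerivedChain K K
  | step {L : Geometry.SimplicialComplex ℝ E} {β : Finset E → E →₀ ℝ} (h : DerivedChain K L)
      (hβ : IsWeighting β) : DerivedChain K (hβ.derived L)

/-- Two complexes with the same support and the same boundary have iterated derived subdivisions
with the same boundary all of whose faces lie on one side of the given hyperplanes. -/
lemma exists_oneSided_derived [FiniteDimensional ℝ E] (l : List (E × ℝ →ₗ[ℝ] ℝ))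
    {K₁ K₂ : Geometry.SimplicialComplex ℝ E} (hK₁ : K₁.faces.Finite) (hK₂ : K₂.faces.Finite)
    (hK : K₁.space = K₂.space) (hbd : K₁.boundaryFaces = K₂.boundaryFaces) :
    ∃ B₁ B₂ : Geometry.SimplicialComplex ℝ E,
      IsIterDerived l.length B₁ K₁ ∧ IsIterDerived l.length B₂ K₂ ∧
      DerivedChain K₁ B₁ ∧ DerivedChain K₂ B₂ ∧ B₁.faces.Finite ∧ B₂.faces.Finite ∧
      B₁.space = K₁.space ∧ B₂.space = K₂.space ∧ B₁.boundaryFaces = B₂.boundaryFaces ∧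
      ∀ f ∈ l, (∀ A ∈ B₁.faces, OneSided f A) ∧ ∀ A ∈ B₂.faces, OneSided f A := by
  induction l with
  | nil => exact ⟨K₁, K₂, rfl, rfl, .refl, .refl, hK₁, hK₂, rfl, rfl, hbd, by simp⟩
  | cons f l ih =>
    obtain ⟨B₁, B₂, i₁, i₂, d₁, d₂, f₁, f₂, s₁, s₂, hb, hl⟩ := ih
    obtain ⟨β, hβ, hf⟩ := exists_adapted_weighting f
    have hs : B₁.space = B₂.space := by rw [s₁, s₂, hK]
    refine ⟨hβ.derived B₁, hβ.derived B₂, ⟨B₁, i₁, hβ.isDerivedSubdivision B₁⟩,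
      ⟨B₂, i₂, hβ.isDerivedSubdivision B₂⟩, d₁.step hβ, d₂.step hβ, hβ.finite_derived B₁ f₁,
      hβ.finite_derived B₂ f₂, by rw [hβ.space_derived, s₁], by rw [hβ.space_derived, s₂],
      (hβ.boundaryFaces_derived_subset f₁ hs hb.le).antisymm
        (hβ.boundaryFaces_derived_subset f₂ hs.symm hb.ge), fun g hg => ?_⟩
    rcases List.mem_cons.1 hg with rfl | hg
    · exact ⟨hβ.oneSided_derived_of_adapted hf, hβ.oneSided_derived_of_adapted hf⟩
    · exact ⟨hβ.oneSided_derived_of_forall (hl g hg).1, hβ.oneSided_derived_of_forall (hl g hg).2⟩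

/-! ### Barycentric coordinates with respect to full-dimensional simplices -/

open Module (finrank)

section

variable [FiniteDimensional ℝ E]

lemma exists_coord {σ : Finset E} (hσ : AffineIndependent ℝ ((↑) : σ → E))
    (hcard : σ.card = finrank ℝ E + 1) :
    ∃ c : E × ℝ →ₗ[ℝ] (E →₀ ℝ), ∀ z, (c z).support ⊆ σ ∧ hbary (c z) = z := by
  let ι : (σ →₀ ℝ) →ₗ[ℝ] (E →₀ ℝ) := Finsupp.lmapDomain ℝ ℝ ((↑) : σ → E)
  have hι : ∀ g, (ι g).support ⊆ σ := fun g v hv => by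
    obtain ⟨i, -, rfl⟩ := Finset.mem_image.1 (Finsupp.mapDomain_support hv)
    exact i.2
  have hinj : Function.Injective (hbary ∘ₗ ι) := by
    refine (injective_iff_map_eq_zero _).2 fun g h => ?_
    exact Finsupp.mapDomain_injective Subtype.val_injective
      (((affineIndependent_iff_hbary σ).1 hσ _ (hι g) h).trans (map_zero ι).symm)
  have hrank : finrank ℝ (σ →₀ ℝ) = finrank ℝ (E × ℝ) := by
    rw [Module.finrank_finsupp_self, Module.finrank_prod, Module.finrank_self]
    simpa using hcard
  let ψ := LinearEquiv.ofInjectiveOfFinrankEq (hbary ∘ₗ ι) hinj hrank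
  exact ⟨ι ∘ₗ ψ.symm.toLinearMap, fun z => ⟨hι _, ψ.apply_symm_apply z⟩⟩

/-- Barycentric coordinates with respect to a full-dimensional simplex. -/
noncomputable def coord (σ : Finset E) : E × ℝ →ₗ[ℝ] (E →₀ ℝ) :=
  if h : AffineIndependent ℝ ((↑) : σ → E) ∧ σ.card = finrank ℝ E + 1 then
    (exists_coord h.1 h.2).choose else 0

/-- A single barycentric coordinate with respect to a full-dimensional simplex. -/
noncomputable def coordFn (σ : Finset E) (v : E) : E × ℝ →ₗ[ℝ] ℝ :=
  Finsupp.lapply v ∘ₗ coord σ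

lemma coordFn_apply (σ : Finset E) (v : E) (z : E × ℝ) : coordFn σ v z = coord σ z v := rfl

lemma continuous_coordFn (σ : Finset E) (v : E) : Continuous fun y : E => coordFn σ v (y, 1) :=
  (LinearMap.continuous_of_finiteDimensional (coordFn σ v)).comp (by fun_prop)

namespace Geometry.SimplicialComplex

/-- The full-dimensional simplices of a complex. -/
def IsTop (L : Geometry.SimplicialComplex ℝ E) (σ : Finset E) : Prop :=
  σ ∈ L.faces ∧ σ.card = finrank ℝ E + 1

variable {L : Geometry.SimplicialComplex ℝ E}

lemma IsTop.coord_spec {σ : Finset E} (hσ : L.IsTop σ) (z : E × ℝ) :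
    (coord σ z).support ⊆ σ ∧ hbary (coord σ z) = z := by
  have h : AffineIndependent ℝ ((↑) : σ → E) ∧ σ.card = finrank ℝ E + 1 := ⟨L.indep hσ.1, hσ.2⟩
  rw [coord, dif_pos h]
  exact (exists_coord h.1 h.2).choose_spec z

variable {σ : Finset E} (hσ : L.IsTop σ)
include hσ

namespace IsTop

lemma support_coord (z : E × ℝ) : (coord σ z).support ⊆ σ := (hσ.coord_spec z).1

lemma hbary_coord (z : E × ℝ) : hbary (coord σ z) = z := (hσ.coord_spec z).2

lemma coord_hbary {w : E →₀ ℝ} (hw : w.support ⊆ σ) : coord σ (hbary w) = w :=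
  hbary_pos_ext (L.indep hσ.1) (hσ.support_coord _) hw (hσ.hbary_coord _)

lemma coord_vertex {v : E} (hv : v ∈ σ) : coord σ (v, 1) = Finsupp.single v 1 := by
  have h : hbary (Finsupp.single v (1 : ℝ)) = (v, 1) := by rw [hbary_single, one_smul]
  rw [← h]
  exact hσ.coord_hbary (Finsupp.support_single_subset.trans (Finset.singleton_subset_iff.2 hv))

lemma coordFn_self {v : E} (hv : v ∈ σ) : coordFn σ v (v, 1) = 1 := by
  rw [coordFn_apply, hσ.coord_vertex hv, Finsupp.single_eq_same]

lemma coordFn_of_ne {u v : E} (hu : u ∈ σ) (huv : u ≠ v) : coordFn σ v (u, 1) = 0 := by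
  rw [coordFn_apply, hσ.coord_vertex hu, Finsupp.single_eq_of_ne huv.symm]

lemma coordFn_ne_zero {v : E} (hv : v ∈ σ) : coordFn σ v ≠ 0 := fun h => by
  have := hσ.coordFn_self hv
  simp [h] at this

lemma coordFn_of_notMem {v : E} (hv : v ∉ σ) (z : E × ℝ) : coordFn σ v z = 0 :=
  Finsupp.notMem_support_iff.1 fun h => hv (hσ.support_coord z h)

lemma mem_convexHull_iff {y : E} :
    y ∈ convexHull ℝ (σ : Set E) ↔ ∀ v ∈ σ, 0 ≤ coordFn σ v (y, 1) := by
  rw [mem_convexHull_iff_hbary]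
  constructor
  · rintro ⟨w, w0, hw, hy⟩ v -
    rw [coordFn_apply, ← hy, hσ.coord_hbary hw]
    exact w0 v
  · refine fun h => ⟨coord σ (y, 1), fun v => ?_, hσ.support_coord _, hσ.hbary_coord _⟩
    by_cases hv : v ∈ σ
    · exact h v hv
    · exact (hσ.coordFn_of_notMem hv _).ge

lemma mem_convexHull_of_subset {F : Finset E} {y : E} (hy : y ∈ convexHull ℝ (σ : Set E))
    (h : ∀ v ∈ σ, v ∉ F → coordFn σ v (y, 1) = 0) : y ∈ convexHull ℝ (F : Set E) := by
  refine mem_convexHull_iff_hbary.2 ⟨coord σ (y, 1), fun v => ?_, fun v hv => ?_,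
    hσ.hbary_coord _⟩
  · by_cases hv : v ∈ σ
    · exact hσ.mem_convexHull_iff.1 hy v hv
    · exact (hσ.coordFn_of_notMem hv _).ge
  · by_contra hvF
    exact Finsupp.mem_support_iff.1 hv (h v (hσ.support_coord _ hv) hvF)

/-- The coordinates at the vertices opposite to a common facet are proportional. -/
lemma coordFn_eq_mul {σ' F : Finset E} {v v' : E} (hσ' : L.IsTop σ')
    (hF : σ = insert v F) (hF' : σ' = insert v' F) (hv : v ∉ F) (hv' : v' ∉ F) (z : E × ℝ) :
    coordFn σ v z = coordFn σ v (v', 1) * coordFn σ' v' z := by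
  conv_lhs => rw [← hσ'.hbary_coord z]
  rw [map_hbary _ ((hσ'.support_coord z).trans hF'.le), Finset.sum_insert hv',
    Finset.sum_eq_zero (s := F), add_zero, mul_comm, coordFn_apply σ' v']
  intro u hu
  rw [hσ.coordFn_of_ne (hF ▸ Finset.mem_insert_of_mem hu) (by rintro rfl; exact hv hu), mul_zero]

/-- Simplices sharing a facet lie on opposite sides of it. -/
lemma coordFn_neg {σ' F : Finset E} {v v' : E} (hσ' : L.IsTop σ')
    (hF : σ = insert v F) (hF' : σ' = insert v' F) (hv' : v' ∉ F) (hne : v ≠ v') :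
    coordFn σ v (v', 1) < 0 := by
  by_contra! h
  have hv'σ : v' ∉ σ := by simp [hF, hv', hne.symm]
  set c := coord σ (v', 1) with hc
  set M := ∑ u ∈ F, |c u| with hM
  set I : E →₀ ℝ := Finsupp.indicator F fun _ _ => M with hI
  have hM0 : 0 ≤ M := Finset.sum_nonneg fun u _ => abs_nonneg _
  have hI0 : ∀ u, 0 ≤ I u := indicator_nonneg fun _ => hM0
  have hIs : I.support ⊆ F := support_indicator_subset' F _
  have hcs : c.support ⊆ σ := hσ.support_coord _
  have key : I + Finsupp.single v' 1 = I + c := by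
    refine L.eq_of_hbary_eq (s := σ') (t := σ) (fun u => add_nonneg (hI0 u) ?_) (fun u => ?_)
      hσ'.1 ?_ hσ.1 ?_ ?_
    · rw [Finsupp.single_apply]; split_ifs; exacts [zero_le_one, le_rfl]
    · by_cases hu : u ∈ F
      · rw [Finsupp.add_apply, hI, indicator_apply_mem (fun _ => M) hu]
        have := Finset.single_le_sum (f := fun u => |c u|) (fun u _ => abs_nonneg (c u)) hu
        linarith [neg_abs_le (c u)]
      · refine add_nonneg (hI0 u) ?_
        by_cases huv : u = v
        · rw [huv]; exact h
        · refine (hσ.coordFn_of_notMem (v := u) ?_ (v', 1)).ge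
          simp [hF, hu, huv]
    · refine Finsupp.support_add.trans (Finset.union_subset (hIs.trans ?_) ?_)
      · rw [hF']; exact Finset.subset_insert _ _
      · refine Finsupp.support_single_subset.trans ?_
        simp [hF']
    · refine Finsupp.support_add.trans (Finset.union_subset (hIs.trans ?_) hcs)
      rw [hF]; exact Finset.subset_insert _ _
    · rw [map_add, map_add, hbary_single, hc, hσ.hbary_coord, one_smul]
  have h1 := DFunLike.congr_fun (add_left_cancel key) v'
  rw [Finsupp.single_eq_same, Finsupp.notMem_support_iff.1 fun h => hv'σ (hcs h)] at h1
  exact one_ne_zero h1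

end IsTop

end Geometry.SimplicialComplex

end

/-! ### Full-dimensional simplices of a complex with a star-convex support -/

section

open Module (finrank)

lemma exists_interior_weights {A : Finset E} (hA : A.Nonempty) :
    ∃ (w : E →₀ ℝ) (y : E), (∀ v, 0 ≤ w v) ∧ w.support = A ∧ hbary w = (y, 1) := by
  obtain ⟨β, hβ, -⟩ := exists_adapted_weighting (0 : E × ℝ →ₗ[ℝ] ℝ)
  exact ⟨β A, innerPoint β A, hβ.nonneg A, hβ.support A, hβ.hbary_eq hA⟩

lemma map_eq_zero_of_mem_convexHull {f : E × ℝ →ₗ[ℝ] ℝ} {A : Finset E}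
    (h : ∀ v ∈ A, f (v, 1) = 0) {y : E} (hy : y ∈ convexHull ℝ (A : Set E)) : f (y, 1) = 0 := by
  obtain ⟨w, -, hw, hwy⟩ := mem_convexHull_iff_hbary.1 hy
  rw [← hwy, map_hbary f hw]
  exact Finset.sum_eq_zero fun v hv => by rw [h v hv, mul_zero]

namespace Geometry.SimplicialComplex

variable {L : Geometry.SimplicialComplex ℝ E}

lemma IsTop.exists_insert {σ F : Finset E} (hσ : L.IsTop σ) (hF : F.card = finrank ℝ E)
    (h : F ⊆ σ) : ∃ v ∉ F, σ = insert v F := by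
  obtain ⟨v, hv⟩ := Finset.card_eq_one.1 (show (σ \ F).card = 1 by
    rw [Finset.card_sdiff_of_subset h, hσ.2, hF]; omega)
  have hv' : v ∈ σ \ F := by simp [hv]
  refine ⟨v, (Finset.mem_sdiff.1 hv').2, ?_⟩
  rw [Finset.insert_eq, ← hv, Finset.sdiff_union_of_subset h]

lemma IsTop.erase_mem {σ : Finset E} (hσ : L.IsTop σ) (hd : 0 < finrank ℝ E) {v : E}
    (hv : v ∈ σ) : σ.erase v ∈ L.faces ∧ (σ.erase v).card = finrank ℝ E := by
  have hc : (σ.erase v).card = finrank ℝ E := by rw [Finset.card_erase_of_mem hv, hσ.2]; rfl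
  exact ⟨L.down_closed hσ.1 (Finset.erase_subset _ _) (Finset.card_pos.1 (hc ▸ hd)), hc⟩

end Geometry.SimplicialComplex

variable [FiniteDimensional ℝ E]

lemma exists_generic {U : Set E} (hU : IsOpen U) (hne : U.Nonempty)
    (s : Finset (E × ℝ →ₗ[ℝ] ℝ)) (hs : ∀ f ∈ s, f ≠ 0) : ∃ y ∈ U, ∀ f ∈ s, f (y, 1) ≠ 0 := by
  induction s using Finset.induction_on with
  | empty =>
    obtain ⟨y, hy⟩ := hne
    exact ⟨y, hy, by simp⟩
  | insert f s hf ih =>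
    obtain ⟨y, hyU, hy⟩ := ih fun g hg => hs g (Finset.mem_insert_of_mem hg)
    have hcont : ∀ g : E × ℝ →ₗ[ℝ] ℝ, Continuous fun y : E => g (y, 1) := fun g =>
      (LinearMap.continuous_of_finiteDimensional g).comp (by fun_prop)
    by_cases hfy : f (y, 1) = 0
    · obtain ⟨z, hz⟩ : ∃ z : E, f (z, 0) ≠ 0 := by
        by_contra! h
        refine hs f (Finset.mem_insert_self _ _) (LinearMap.ext fun p => ?_)
        have : p = (p.1 - p.2 • y, 0) + p.2 • (y, 1) := by ext <;> simp
        rw [this, map_add, map_smul, h, hfy]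
        simp
      have hev : ∀ᶠ y' in nhds y, y' ∈ U ∧ ∀ g ∈ s, g (y', 1) ≠ 0 :=
        Filter.Eventually.and (hU.mem_nhds hyU) ((Finset.eventually_all s).2 fun g hg =>
          (hcont g).continuousAt.eventually_ne (hy g hg))
      have hc : Filter.Tendsto (fun ε : ℝ => y + ε • z) (nhds 0) (nhds y) := by
        have : Continuous fun ε : ℝ => y + ε • z := by fun_prop
        simpa using this.tendsto 0
      obtain ⟨ε, h1, h2⟩ := (((hc.eventually hev).filter_mono nhdsWithin_le_nhds).and
        (self_mem_nhdsWithin (s := Ioi (0 : ℝ)))).exists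
      refine ⟨y + ε • z, h1.1, fun g hg => ?_⟩
      rcases Finset.mem_insert.1 hg with rfl | hg
      · have : (y + ε • z, (1 : ℝ)) = (y, 1) + ε • (z, 0) := by ext <;> simp
        rw [this, map_add, map_smul, hfy, zero_add, smul_eq_mul]
        exact mul_ne_zero (ne_of_gt h2) hz
      · exact h1.2 g hg
    · refine ⟨y, hyU, fun g hg => ?_⟩
      rcases Finset.mem_insert.1 hg with rfl | hg
      exacts [hfy, hy g hg]

lemma exists_functional_vanishing {A : Finset E} (hA : A.card ≤ finrank ℝ E) :
    ∃ f : E × ℝ →ₗ[ℝ] ℝ, f ≠ 0 ∧ ∀ v ∈ A, f (v, 1) = 0 := by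
  have hlt : Submodule.span ℝ 
      ((A.image fun v => (v, (1 : ℝ)) : Finset (E × ℝ)) : Set (E × ℝ)) < ⊤ := by
    refine lt_top_iff_ne_top.2 fun h => ?_
    have h1 := finrank_span_finset_le_card (R := ℝ) (A.image fun v => (v, (1 : ℝ)))
    rw [Set.finrank, h, finrank_top, Module.finrank_prod, Module.finrank_self] at h1
    have := Finset.card_image_le (s := A) (f := fun v => (v, (1 : ℝ)))
    omega
  obtain ⟨f, hf, hle⟩ := Submodule.exists_le_ker_of_lt_top _ hlt
  exact ⟨f, hf, fun v hv => hle (Submodule.subset_span (by simpa using hv))⟩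

namespace Geometry.SimplicialComplex

variable {L : Geometry.SimplicialComplex ℝ E}

lemma card_le {A : Finset E} (hA : A ∈ L.faces) : A.card ≤ finrank ℝ E + 1 := by
  have h := (L.indep hA).card_le_finrank_succ
  have h2 := Submodule.finrank_le (vectorSpan ℝ (Set.range ((↑) : A → E)))
  rw [Fintype.card_coe] at h
  omega

lemma exists_isTop_superset (hL : L.faces.Finite) (hcl : L.space ⊆ closure (interior L.space))
    {A : Finset E} (hA : A ∈ L.faces) : ∃ σ, L.IsTop σ ∧ A ⊆ σ := by
  obtain ⟨w, y, w0, rfl, hy⟩ := exists_interior_weights (L.nonempty_of_mem_faces hA)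
  have hyL : y ∈ L.space := mem_space_iff_hbary.2 ⟨w, w0, hA, hy⟩
  obtain ⟨V, hV, hVo, hyV⟩ := eventually_nhds_iff.1 (eventually_exists_superset hL w0 hA hy)
  choose! f hf0 hf using fun (B : Finset E) (h : B.card ≤ finrank ℝ E) =>
    exists_functional_vanishing h
  obtain ⟨z, hz, hzf⟩ := exists_generic (hVo.inter isOpen_interior)
    (mem_closure_iff.1 (hcl hyL) V hVo hyV)
    ((hL.toFinset.filter fun B => B.card ≤ finrank ℝ E).image f) (by
      intro g hg
      obtain ⟨B, hB, rfl⟩ := Finset.mem_image.1 hg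
      exact hf0 B (Finset.mem_filter.1 hB).2)
  obtain ⟨G, hG, hwG, hzG⟩ := hV z hz.1 (interior_subset hz.2)
  refine ⟨G, ⟨hG, le_antisymm (card_le hG) ?_⟩, hwG⟩
  by_contra h
  rw [not_le, Nat.lt_succ_iff] at h
  exact hzf (f G) (Finset.mem_image_of_mem _ (Finset.mem_filter.2 ⟨hL.mem_toFinset.2 hG, h⟩))
    (map_eq_zero_of_mem_convexHull (hf G h) hzG)

/-- A facet lies in at most two full-dimensional simplices. -/
lemma IsTop.eq_or_eq {σ₁ σ₂ σ₃ F : Finset E} (h₁ : L.IsTop σ₁) (h₂ : L.IsTop σ₂)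
    (h₃ : L.IsTop σ₃) (hF : F.card = finrank ℝ E) (hF₁ : F ⊆ σ₁) (hF₂ : F ⊆ σ₂) (hF₃ : F ⊆ σ₃)
    (hne : σ₁ ≠ σ₂) : σ₃ = σ₁ ∨ σ₃ = σ₂ := by
  obtain ⟨v₁, hv₁, e₁⟩ := h₁.exists_insert hF hF₁
  obtain ⟨v₂, hv₂, e₂⟩ := h₂.exists_insert hF hF₂
  obtain ⟨v₃, hv₃, e₃⟩ := h₃.exists_insert hF hF₃
  by_contra! h
  have n₁₂ : v₁ ≠ v₂ := by rintro rfl; exact hne (e₁.trans e₂.symm)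
  have n₁₃ : v₁ ≠ v₃ := by rintro rfl; exact h.1 (e₃.trans e₁.symm)
  have n₂₃ : v₂ ≠ v₃ := by rintro rfl; exact h.2 (e₃.trans e₂.symm)
  have a := h₁.coordFn_neg h₂ e₁ e₂ hv₂ n₁₂
  have b := h₁.coordFn_neg h₃ e₁ e₃ hv₃ n₁₃
  have c := h₂.coordFn_neg h₃ e₂ e₃ hv₃ n₂₃
  rw [h₁.coordFn_eq_mul h₂ e₁ e₂ hv₁ hv₂] at b
  exact b.not_gt (mul_pos_of_neg_of_neg a c)

/-- A facet contained in the frontier lies in a unique full-dimensional simplex. -/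
lemma IsTop.eq_of_subset_frontier {σ σ' F : Finset E} (hσ : L.IsTop σ) (hσ' : L.IsTop σ')
    (hF : F.card = finrank ℝ E) (hF0 : F.Nonempty) (hFσ : F ⊆ σ) (hFσ' : F ⊆ σ')
    (hfr : convexHull ℝ (F : Set E) ⊆ frontier L.space) : σ = σ' := by
  by_contra hne
  obtain ⟨v, hv, e⟩ := hσ.exists_insert hF hFσ
  obtain ⟨v', hv', e'⟩ := hσ'.exists_insert hF hFσ'
  have hvv : v ≠ v' := by rintro rfl; exact hne (e.trans e'.symm)
  obtain ⟨w, y, w0, rfl, hy⟩ := exists_interior_weights hF0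
  refine (hfr (mem_convexHull_iff_hbary.2 ⟨w, w0, subset_rfl, hy⟩)).2 ?_
  have pos : ∀ {τ : Finset E}, L.IsTop τ → w.support ⊆ τ → ∀ u ∈ w.support,
      ∀ᶠ z in nhds y, 0 < coordFn τ u (z, 1) := by
    intro τ hτ hs u hu
    refine (continuous_coordFn τ u).continuousAt.eventually_const_lt ?_
    beta_reduce
    rw [coordFn_apply, ← hy, hτ.coord_hbary hs]
    exact lt_of_le_of_ne (w0 u) (Ne.symm (Finsupp.mem_support_iff.1 hu))
  rw [mem_interior_iff_mem_nhds]
  filter_upwards [(Finset.eventually_all _).2 (pos hσ hFσ),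
    (Finset.eventually_all _).2 (pos hσ' hFσ')] with z hz hz'
  have mem : ∀ {τ : Finset E} {t : E}, L.IsTop τ → τ = insert t w.support →
      (∀ u ∈ w.support, 0 < coordFn τ u (z, 1)) → 0 ≤ coordFn τ t (z, 1) → z ∈ L.space := by
    intro τ t hτ e h ht
    refine mem_space_iff.2 ⟨τ, hτ.1, hτ.mem_convexHull_iff.2 fun u hu => ?_⟩
    rw [e, Finset.mem_insert] at hu
    rcases hu with rfl | hu
    exacts [ht, (h u hu).le]
  rcases le_or_gt 0 (coordFn σ v (z, 1)) with h | h
  · exact mem hσ e hz h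
  · refine mem hσ' e' hz' ?_
    rw [hσ.coordFn_eq_mul hσ' e e' hv hv'] at h
    exact (pos_of_mul_neg_right h (hσ.coordFn_neg hσ' e e' hv' hvv).le).le

/-- A facet lying in a unique full-dimensional simplex is contained in the frontier. -/
lemma IsTop.subset_frontier_of_unique (hL : L.faces.Finite)
    (hcl : L.space ⊆ closure (interior L.space)) {σ F : Finset E} (hσ : L.IsTop σ)
    (hF : F.card = finrank ℝ E) (hF0 : F.Nonempty) (hFσ : F ⊆ σ)
    (huniq : ∀ σ', L.IsTop σ' → F ⊆ σ' → σ' = σ) :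
    convexHull ℝ (F : Set E) ⊆ frontier L.space := by
  obtain ⟨v, hv, e⟩ := hσ.exists_insert hF hFσ
  have hFL := L.down_closed hσ.1 hFσ hF0
  obtain ⟨w, y, w0, rfl, hy⟩ := exists_interior_weights hF0
  have hyL : y ∈ L.space := mem_space_iff_hbary.2 ⟨w, w0, hFL, hy⟩
  refine convexHull_subset_frontier hL w0 hFL hy ⟨subset_closure hyL, fun hyi => ?_⟩
  have hy0 : coordFn σ v (y, 1) = 0 := by
    rw [coordFn_apply, ← hy, hσ.coord_hbary hFσ]
    exact Finsupp.notMem_support_iff.1 hv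
  have hvσ : v ∈ σ := by simp [e]
  have hev := (eventually_exists_superset hL w0 hFL hy).and (isOpen_interior.mem_nhds hyi)
  have hc : Filter.Tendsto (fun ε : ℝ => y - ε • (v - y)) (nhds 0) (nhds y) := by
    have : Continuous fun ε : ℝ => y - ε • (v - y) := by fun_prop
    simpa using this.tendsto 0
  obtain ⟨ε, h1, h2⟩ := (((hc.eventually hev).filter_mono nhdsWithin_le_nhds).and
    (self_mem_nhdsWithin (s := Ioi (0 : ℝ)))).exists
  obtain ⟨G, hG, hwG, hyG⟩ := h1.1 (interior_subset h1.2)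
  obtain ⟨τ, hτ, hGτ⟩ := exists_isTop_superset hL hcl hG
  obtain rfl := huniq τ hτ (hwG.trans hGτ)
  have h3 := hτ.mem_convexHull_iff.1 (convexHull_mono (Finset.coe_subset.2 hGτ) hyG) v hvσ
  have : (y - ε • (v - y), (1 : ℝ)) = (1 + ε) • (y, 1) - ε • (v, 1) := by
    ext
    · simp only [Prod.fst_sub, Prod.smul_fst]; module
    · simp
  rw [this, map_sub, map_smul, map_smul, hy0, hτ.coordFn_self hvσ] at h3
  simp only [smul_eq_mul, mul_zero, mul_one, zero_sub] at h3
  have : (0 : ℝ) < ε := h2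
  linarith

/-- The centre of a star-convex support lies strictly inside every boundary facet. -/
lemma IsTop.coordFn_center_pos (hL : L.faces.Finite)
    (hcl : L.space ⊆ closure (interior L.space)) {x : E}
    (hx : ∀ y ∈ L.space, ∀ t ∈ Set.Ioo (0 : ℝ) 1, (1 - t) • x + t • y ∈ interior L.space)
    {σ F : Finset E} (hσ : L.IsTop σ) (hF : F.card = finrank ℝ E) (hF0 : F.Nonempty) {v : E}
    (hv : v ∉ F) (e : σ = insert v F) (hfr : convexHull ℝ (F : Set E) ⊆ frontier L.space) :
    0 < coordFn σ v (x, 1) := by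
  have hFσ : F ⊆ σ := e ▸ Finset.subset_insert _ _
  have hFL := L.down_closed hσ.1 hFσ hF0
  obtain ⟨w, y, w0, rfl, hy⟩ := exists_interior_weights hF0
  have hyL : y ∈ L.space := mem_space_iff_hbary.2 ⟨w, w0, hFL, hy⟩
  have hy0 : coordFn σ v (y, 1) = 0 := by
    rw [coordFn_apply, ← hy, hσ.coord_hbary hFσ]
    exact Finsupp.notMem_support_iff.1 hv
  have hvσ : v ∈ σ := by simp [e]
  have hc : Filter.Tendsto (fun ε : ℝ => (1 - (1 - ε)) • x + (1 - ε) • y) (nhds 0) (nhds y) := by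
    have : Continuous fun ε : ℝ => (1 - (1 - ε)) • x + (1 - ε) • y := by fun_prop
    simpa using this.tendsto 0
  obtain ⟨ε, h1, h2⟩ := (((hc.eventually (eventually_exists_superset hL w0 hFL hy)).filter_mono
    nhdsWithin_le_nhds).and (Ioo_mem_nhdsGT (zero_lt_one' ℝ))).exists
  have hyint := hx y hyL (1 - ε) ⟨by linarith [h2.2], by linarith [h2.1]⟩
  obtain ⟨G, hG, hwG, hyG⟩ := h1 (interior_subset hyint)
  obtain ⟨τ, hτ, hGτ⟩ := exists_isTop_superset hL hcl hG
  obtain rfl := hτ.eq_of_subset_frontier hσ hF hF0 (hwG.trans hGτ) hFσ hfr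
  have hmem := convexHull_mono (Finset.coe_subset.2 hGτ) hyG
  have h3 := hτ.mem_convexHull_iff.1 hmem v hvσ
  have hlin : ((1 - (1 - ε)) • x + (1 - ε) • y, (1 : ℝ)) = ε • (x, 1) + (1 - ε) • (y, 1) := by
    ext <;> simp
  have h4 : coordFn τ v ((1 - (1 - ε)) • x + (1 - ε) • y, 1) = ε * coordFn τ v (x, 1) := by
    rw [hlin, map_add, map_smul, map_smul, hy0]
    simp
  by_contra! hneg
  have h5 : coordFn τ v ((1 - (1 - ε)) • x + (1 - ε) • y, 1) = 0 :=
    le_antisymm (h4 ▸ mul_nonpos_of_nonneg_of_nonpos h2.1.le hneg) h3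
  refine (hfr (hτ.mem_convexHull_of_subset hmem fun u hu huF => ?_)).2 hyint
  rw [e, Finset.mem_insert] at hu
  rcases hu with rfl | hu
  exacts [h5, (huF hu).elim]

end Geometry.SimplicialComplex

end

/-! ### Ordering the full-dimensional simplices of a derived subdivision -/

section

open Module (finrank)

/-- Lexicographic comparison of sequences, the last entries being the most significant. -/
def LexLT (f g : ℕ → ℝ) : Prop := ∃ k, (∀ j > k, f j = g j) ∧ f k < g k

lemma LexLT.irrefl (f : ℕ → ℝ) : ¬ LexLT f f := fun ⟨_, _, h⟩ => lt_irrefl _ h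

lemma LexLT.trans {f g h : ℕ → ℝ} : LexLT f g → LexLT g h → LexLT f h := by
  rintro ⟨k, hk, hk'⟩ ⟨l, hl, hl'⟩
  refine ⟨max k l, fun j hj => (hk j ?_).trans (hl j ?_), ?_⟩
  · exact (le_max_left k l).trans_lt hj
  · exact (le_max_right k l).trans_lt hj
  · rcases lt_trichotomy k l with h | rfl | h
    · rw [max_eq_right h.le, hk l h]; exact hl'
    · rw [max_self]; exact hk'.trans hl'
    · rw [max_eq_left h.le, ← hl k h]; exact hk'

lemma IsFlag.card_injOn {α : Type*} {T : Finset (Finset α)} (h : IsFlag T) :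
    Set.InjOn Finset.card (T : Set (Finset α)) := fun A hA B hB hAB =>
  (h A hA B hB).elim (fun hs => Finset.eq_of_subset_of_card_le hs hAB.ge)
    fun hs => (Finset.eq_of_subset_of_card_le hs hAB.le).symm

lemma IsFlag.subset_of_card_le {α : Type*} {T : Finset (Finset α)} (h : IsFlag T)
    {A B : Finset α} (hA : A ∈ T) (hB : B ∈ T) (hAB : A.card ≤ B.card) : A ⊆ B :=
  (h A hA B hB).elim id fun hs => (Finset.eq_of_subset_of_card_le hs hAB).ge

/-- A flag with exactly one member of every cardinality from `1` to `N`. -/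
structure IsCompleteFlag {α : Type*} (N : ℕ) (T : Finset (Finset α)) : Prop where
  isFlag : IsFlag T
  nonempty : ∀ A ∈ T, A.Nonempty
  card_le : ∀ A ∈ T, A.card ≤ N
  card_eq : T.card = N

lemma IsCompleteFlag.exists_card_eq {α : Type*} {N : ℕ} {T : Finset (Finset α)}
    (h : IsCompleteFlag N T) {j : ℕ} (h1 : 1 ≤ j) (hN : j ≤ N) : ∃ A ∈ T, A.card = j := by
  have hsub : T.image Finset.card ⊆ Finset.Icc 1 N := by
    intro i hi
    obtain ⟨A, hA, rfl⟩ := Finset.mem_image.1 hi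
    exact Finset.mem_Icc.2 ⟨Finset.card_pos.2 (h.nonempty A hA), h.card_le A hA⟩
  have heq := Finset.eq_of_subset_of_card_le hsub (by
    rw [Finset.card_image_of_injOn h.isFlag.card_injOn, h.card_eq]; simp)
  exact Finset.mem_image.1 (heq ▸ Finset.mem_Icc.2 ⟨h1, hN⟩)

/-- The total weight of the sets of each cardinality. -/
noncomputable def levelSum {α : Type*} (W : Finset α →₀ ℝ) (j : ℕ) : ℝ :=
  Finsupp.linearCombination ℝ (fun B : Finset α => if B.card = j then (1 : ℝ) else 0) W

lemma levelSum_sub {α : Type*} (W W' : Finset α →₀ ℝ) (j : ℕ) :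
    levelSum W j - levelSum W' j = ∑ B ∈ (W - W').support, if B.card = j then (W - W') B else 0 := by
  rw [levelSum, levelSum, ← map_sub, Finsupp.linearCombination_apply, Finsupp.sum]
  simp

omit [NormedAddCommGroup E] [NormedSpace ℝ E] in
lemma expand_eq_single {β : Finset E → E →₀ ℝ} {V : Finset E →₀ ℝ} {A : Finset E} {u : E}
    (h : ∀ D ∈ V.support, D ≠ A → β D u = 0) : expand β V u = V A * β A u := by
  rw [expand_apply]
  exact Finset.sum_eq_single A (fun D hD hDA => by rw [h D hD hDA, mul_zero])
    (fun h' => by rw [Finsupp.notMem_support_iff.1 h', zero_mul])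

/-- Crossing an interior facet of the barycentric subdivision of a simplex away from a point
decreases the coordinates of the point lexicographically. -/
lemma IsWeighting.lexLT_of_erase_subset {β : Finset E → E →₀ ℝ} (hβ : IsWeighting β) {N : ℕ}
    {T T' : Finset (Finset E)} (hT : IsCompleteFlag N T) (hT' : IsCompleteFlag N T')
    {W W' : Finset E →₀ ℝ} (hW : W.support ⊆ T) (hW' : W'.support ⊆ T')
    (h : expand β W = expand β W') {ρ A : Finset E} (hρ : ρ ∈ T') (hρN : ρ.card = N)
    (hA : A ∈ T) (hAT' : A ∉ T') (hsub : T.erase A ⊆ T') (hneg : W A < 0) (hρT : ρ ∈ T) :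
    LexLT (levelSum W') (levelSum W) := by
  have hmem : ∀ {D}, D ∈ T → D.card ≠ A.card → D ∈ T' := fun {D} hD hc =>
    hsub (Finset.mem_erase.2 ⟨by rintro rfl; exact hc rfl, hD⟩)
  have hAρ : A.card < N := lt_of_le_of_ne (hT.card_le A hA) fun hc => hAT' <| by
    rwa [hT.isFlag.card_injOn hA hρT (hc.trans hρN.symm)]
  have hA1 : 1 ≤ A.card := Finset.card_pos.2 (hT.nonempty A hA)
  obtain ⟨B, hB, hBc⟩ := hT.exists_card_eq (j := A.card + 1) (by omega) (by omega)
  have hBT' : B ∈ T' := hmem hB (by omega)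
  obtain ⟨A', hA', hA'c⟩ := hT'.exists_card_eq hA1 hAρ.le
  have hA'A : A' ≠ A := by rintro rfl; exact hAT' hA'
  have hA'B : A' ⊆ B := hT'.isFlag.subset_of_card_le hA' hBT' (by omega)
  have hAB : A ⊆ B := hT.isFlag.subset_of_card_le hA hB (by omega)
  have hsupp : ∀ {D}, D ∈ (W - W').support → D ∈ T ∨ D = A' := by
    intro D hD
    rcases Finset.mem_union.1 (Finsupp.support_sub hD) with hD | hD
    · exact .inl (hW hD)
    replace hD := hW' hD
    by_cases hc : D.card = A.card
    · exact .inr (hT'.isFlag.card_injOn hD hA' (hc.trans hA'c.symm))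
    · obtain ⟨C, hC, hCD⟩ := hT.exists_card_eq (Finset.card_pos.2 (hT'.nonempty D hD))
        (hT'.card_le D hD)
      left
      rwa [← hT'.isFlag.card_injOn (hmem hC (hCD ▸ hc)) hD hCD]
  have h0 : ∀ u, expand β (W - W') u = 0 := fun u => by rw [map_sub, h, sub_self]; rfl
  have high : ∀ D, A.card + 1 < D.card → (W - W') D = 0 := by
    by_contra! hex
    obtain ⟨D₀, hD₀, hD₀'⟩ := hex
    obtain ⟨D, hD, hmax⟩ := ((W - W').support.filter fun D => A.card + 1 < D.card).exists_max_image
      Finset.card ⟨D₀, Finset.mem_filter.2 ⟨Finsupp.mem_support_iff.2 hD₀', hD₀⟩⟩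
    obtain ⟨hDs, hDc⟩ := Finset.mem_filter.1 hD
    have hDT : D ∈ T := (hsupp hDs).resolve_right (by rintro rfl; omega)
    obtain ⟨C, hC, hCc⟩ := hT.exists_card_eq (j := D.card - 1) (by omega)
      (by have := hT.card_le D hDT; omega)
    obtain ⟨u, huD, huC⟩ := Finset.exists_mem_notMem_of_card_lt_card (s := C) (t := D) (by omega)
    have := h0 u
    rw [expand_eq_single (A := D)] at this
    · exact (mul_eq_zero.1 this).elim (Finsupp.mem_support_iff.1 hDs) ((hβ.pos_iff D u).2 huD).ne'
    · intro G hG hGD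
      refine hβ.apply_eq_zero fun huG => huC ?_
      rcases hsupp hG with hGT | rfl
      · refine hT.isFlag.subset_of_card_le hGT hC ?_ huG
        have hGc : G.card ≠ D.card := fun hc => hGD (hT.isFlag.card_injOn hGT hDT hc)
        have : G.card ≤ D.card := by
          by_cases hGA : A.card + 1 < G.card
          · exact hmax G (Finset.mem_filter.2 ⟨hG, hGA⟩)
          · omega
        omega
      · exact hT.isFlag.subset_of_card_le hB hC (by omega) (hA'B huG)
  have hBpos : 0 < (W - W') B := by
    obtain ⟨u, huA, huA'⟩ := Finset.not_subset.1 fun hs : A ⊆ A' =>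
      hA'A (Finset.eq_of_subset_of_card_le hs hA'c.le).symm
    have hBA : B ≠ A := by rintro rfl; omega
    have := h0 u
    rw [expand_apply, Finset.sum_eq_add B A hBA] at this
    · have hVA : (W - W') A = W A := by
        rw [Finsupp.sub_apply, Finsupp.notMem_support_iff.1 fun hs => hAT' (hW' hs), sub_zero]
      rw [hVA] at this
      have h1 := (hβ.pos_iff B u).2 (hAB huA)
      have h2 := mul_neg_of_neg_of_pos hneg ((hβ.pos_iff A u).2 huA)
      exact pos_of_mul_pos_left (by linarith) h1.le
    · rintro D hD ⟨hDB, hDA⟩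
      by_cases hDc : A.card + 1 < D.card
      · rw [high D hDc, zero_mul]
      rw [hβ.apply_eq_zero fun huD => huA' ?_, mul_zero]
      rcases hsupp hD with hDT | rfl
      · have n1 : D.card ≠ A.card := fun hc => hDA (hT.isFlag.card_injOn hDT hA hc)
        have n2 : D.card ≠ B.card := fun hc => hDB (hT.isFlag.card_injOn hDT hB hc)
        exact hT'.isFlag.subset_of_card_le (hmem hDT n1) hA' (by omega) huD
      · exact huD
    · intro h'; rw [Finsupp.notMem_support_iff.1 h', zero_mul]
    · intro h'; rw [Finsupp.notMem_support_iff.1 h', zero_mul]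
  refine ⟨A.card + 1, fun j hj => ?_, ?_⟩
  · rw [eq_comm, ← sub_eq_zero, levelSum_sub]
    refine Finset.sum_eq_zero fun D _ => ?_
    split_ifs with hD
    · exact high D (hD ▸ hj)
    · rfl
  · rw [← sub_pos, levelSum_sub, Finset.sum_eq_single B]
    · rwa [if_pos hBc]
    · intro D hD hDB
      refine if_neg fun hc => hDB ?_
      rcases hsupp hD with hDT | rfl
      · exact hT.isFlag.card_injOn hDT hB (hc.trans hBc.symm)
      · omega
    · intro h'
      rw [Finsupp.notMem_support_iff.1 h', ite_self]

end

section

open Module (finrank)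

variable [FiniteDimensional ℝ E]

namespace Geometry.SimplicialComplex

/-- The full-dimensional simplices `τ'` and `τ` share a facet separating `τ` from the point of
homogeneous coordinates `X`. -/
def Crosses (L : Geometry.SimplicialComplex ℝ E) (X : E × ℝ) (τ' τ : Finset E) : Prop :=
  L.IsTop τ' ∧ L.IsTop τ ∧ τ' ≠ τ ∧ ∃ v ∈ τ, τ.erase v ⊆ τ' ∧ coordFn τ v X < 0

/-- The full-dimensional simplices of `L` inside each full-dimensional simplex of `K` can be
ordered compatibly with `Crosses`. -/
def HasRootOrder (K L : Geometry.SimplicialComplex ℝ E) (X : E × ℝ) : Prop :=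
  ∃ (root : Finset E → Finset E) (lt : Finset E → Finset E → Prop),
    (∀ τ, ¬ lt τ τ) ∧ (∀ τ₁ τ₂ τ₃, lt τ₁ τ₂ → lt τ₂ τ₃ → lt τ₁ τ₃) ∧
    (∀ τ, L.IsTop τ → K.IsTop (root τ) ∧ convexHull ℝ (τ : Set E) ⊆ convexHull ℝ (root τ : Set E)) ∧
    ∀ τ' τ, L.Crosses X τ' τ → root τ' = root τ → lt τ' τ

lemma IsTop.exists_flag {L : Geometry.SimplicialComplex ℝ E} {β : Finset E → E →₀ ℝ}
    (hβ : IsWeighting β) (X : E × ℝ) {τ : Finset E} (hτ : (hβ.derived L).IsTop τ) :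
    ∃ (T : Finset (Finset E)) (ρ : Finset E) (W : Finset E →₀ ℝ), ↑T ⊆ L.faces ∧
      IsCompleteFlag (finrank ℝ E + 1) T ∧ τ = T.image (innerPoint β) ∧ ρ ∈ T ∧ L.IsTop ρ ∧
      (∀ B ∈ T, B ⊆ ρ) ∧ W.support ⊆ T ∧ (∀ A ∈ T, W A = coordFn τ (innerPoint β A) X) ∧
      expand β W = coord ρ X := by
  obtain ⟨T, hT, hTne, hTf, hτT⟩ := hτ.1
  have hTc : IsCompleteFlag (finrank ℝ E + 1) T :=
    ⟨hTf, fun A hA => L.nonempty_of_mem_faces (hT hA), fun A hA => card_le (hT hA), by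
      rw [← hτ.2, hτT, Finset.card_image_of_injOn ((hβ.innerPoint_injOn (K := L)).mono hT)]⟩
  obtain ⟨ρ, hρ, hρc⟩ := hTc.exists_card_eq (j := finrank ℝ E + 1) (by omega) le_rfl
  have hρT : L.IsTop ρ := ⟨hT hρ, hρc⟩
  have htop : ∀ B ∈ T, B ⊆ ρ := fun B hB =>
    hTf.subset_of_card_le hB hρ ((hTc.card_le B hB).trans hρc.ge)
  obtain ⟨W, hW, -, -, -, hWA, hWh⟩ := hβ.exists_lift hT (w := coord τ X)
    (hτT ▸ hτ.support_coord X)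
  refine ⟨T, ρ, W, hT, hTc, hτT, hρ, hρT, htop, hW, hWA, ?_⟩
  rw [← hρT.coord_hbary (hβ.support_expand_subset fun B hB => htop B (hW hB)), hWh,
    hτ.hbary_coord]

lemma HasRootOrder.refl (K : Geometry.SimplicialComplex ℝ E) (X : E × ℝ) : HasRootOrder K K X :=
  ⟨id, fun _ _ => False, fun _ => id, fun _ _ _ h _ => h, fun _ h => ⟨h, subset_rfl⟩,
    fun _ _ h he => h.2.2.1 he⟩

lemma HasRootOrder.derived {K L : Geometry.SimplicialComplex ℝ E} {X : E × ℝ}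
    (h : HasRootOrder K L X) (hd : 0 < finrank ℝ E) {β : Finset E → E →₀ ℝ}
    (hβ : IsWeighting β) : HasRootOrder K (hβ.derived L) X := by
  obtain ⟨root, lt, hirr, htr, hroot, hlt⟩ := h
  choose! T ρ W hT hTc hτT hρ hρT htop hW hWA hWe using
    fun (τ : Finset E) (hτ : (hβ.derived L).IsTop τ) => IsTop.exists_flag hβ X hτ
  refine ⟨fun τ => root (ρ τ), fun τ' τ => lt (ρ τ') (ρ τ) ∨
    (ρ τ' = ρ τ ∧ LexLT (levelSum (W τ')) (levelSum (W τ))), ?_, ?_, ?_, ?_⟩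
  · rintro τ (h | h)
    exacts [hirr _ h, LexLT.irrefl _ h.2]
  · rintro τ₁ τ₂ τ₃ (h | h) (h' | h')
    · exact .inl (htr _ _ _ h h')
    · exact .inl (h'.1 ▸ h)
    · exact .inl (h.1 ▸ h')
    · exact .inr ⟨h.1.trans h'.1, h.2.trans h'.2⟩
  · intro τ hτ
    refine ⟨(hroot _ (hρT τ hτ)).1, Subset.trans ?_ (hroot _ (hρT τ hτ)).2⟩
    have := hβ.convexHull_image_subset (hT τ hτ) (htop τ hτ)
    rwa [← hτT τ hτ] at this
  · rintro τ' τ ⟨hτ', hτ, hne, v, hv, hsub, hneg⟩ hr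
    have hinj := hβ.innerPoint_injOn (K := L)
    obtain ⟨A, hA, rfl⟩ := Finset.mem_image.1 (hτT τ hτ ▸ hv)
    rw [← hWA τ hτ A hA] at hneg
    have hsubT : (T τ).erase A ⊆ T τ' := by
      intro B hB
      obtain ⟨hBA, hB⟩ := Finset.mem_erase.1 hB
      have : innerPoint β B ∈ τ' := hsub (Finset.mem_erase.2
        ⟨fun he => hBA (hinj (hT τ hτ hB) (hT τ hτ hA) he), by
          rw [hτT τ hτ]; exact Finset.mem_image_of_mem _ hB⟩)
      rw [hτT τ' hτ'] at this
      obtain ⟨B', hB', he⟩ := Finset.mem_image.1 this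
      rwa [← hinj (hT τ' hτ' hB') (hT τ hτ hB) he]
    have hAT' : A ∉ T τ' := fun hA' => hne <| by
      rw [hτT τ' hτ', hτT τ hτ, Finset.eq_of_subset_of_card_le (s := T τ) (t := T τ')]
      · intro B hB
        by_cases hBA : B = A
        · rwa [hBA]
        · exact hsubT (Finset.mem_erase.2 ⟨hBA, hB⟩)
      · rw [(hTc τ hτ).card_eq, (hTc τ' hτ').card_eq]
    by_cases hρρ : ρ τ' = ρ τ
    · refine .inr ⟨hρρ, hβ.lexLT_of_erase_subset (hTc τ hτ) (hTc τ' hτ') (hW τ hτ) (hW τ' hτ') ?_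
        (hρ τ' hτ') (hρT τ' hτ').2 hA hAT' hsubT hneg (hρρ ▸ hρ τ hτ)⟩
      rw [hWe τ hτ, hWe τ' hτ', hρρ]
    left
    have hcard : ∀ {B}, B ∈ T τ' → B.card = finrank ℝ E + 1 → B = ρ τ' := fun hB hc =>
      (hTc τ' hτ').isFlag.card_injOn hB (hρ τ' hτ') (hc.trans (hρT τ' hτ').2.symm)
    obtain rfl : A = ρ τ := by
      by_contra hAρ
      exact hρρ (hcard (hsubT (Finset.mem_erase.2 ⟨Ne.symm hAρ, hρ τ hτ⟩)) (hρT τ hτ).2).symm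
    obtain ⟨C, hC, hCc⟩ := (hTc τ hτ).exists_card_eq (j := finrank ℝ E) hd (by omega)
    have hCT' : C ∈ T τ' := hsubT (Finset.mem_erase.2
      ⟨by rintro rfl; have := (hρT τ hτ).2; omega, hC⟩)
    obtain ⟨u, hu, he⟩ := (hρT τ hτ).exists_insert hCc (htop τ hτ C hC)
    have huρ : u ∈ ρ τ := he ▸ Finset.mem_insert_self _ _
    refine hlt _ _ ⟨hρT τ' hτ', hρT τ hτ, hρρ, u, huρ, ?_, ?_⟩ hr
    · rw [he, Finset.erase_insert hu]
      exact htop τ' hτ' C hCT'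
    · rw [coordFn_apply, ← hWe τ hτ, expand_eq_single (A := ρ τ)]
      · exact mul_neg_of_neg_of_pos hneg ((hβ.pos_iff _ _).2 huρ)
      · intro D hD hDρ
        refine hβ.apply_eq_zero fun huD => hu ((hTc τ hτ).isFlag.subset_of_card_le (hW τ hτ hD) hC ?_ huD)
        have h1 := (hTc τ hτ).card_le D (hW τ hτ hD)
        have h2 : D.card ≠ finrank ℝ E + 1 := fun hc => hDρ
          ((hTc τ hτ).isFlag.card_injOn (hW τ hτ hD) (hρ τ hτ) (hc.trans (hρT τ hτ).2.symm))
        omega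

end Geometry.SimplicialComplex

lemma DerivedChain.hasRootOrder {K L : Geometry.SimplicialComplex ℝ E}
    (h : DerivedChain K L) (hd : 0 < finrank ℝ E) (X : E × ℝ) :
    K.HasRootOrder L X := by
  induction h with
  | refl => exact Geometry.SimplicialComplex.HasRootOrder.refl K X
  | step _ hβ ih => exact ih.derived hd hβ

end

section

open Module (finrank)

variable [FiniteDimensional ℝ E] {K L : Geometry.SimplicialComplex ℝ E}

namespace Geometry.SimplicialComplex

lemma IsTop.apply_eq_mul {τ F : Finset E} (hτ : L.IsTop τ) {v : E} (hv : v ∉ F)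
    (e : τ = insert v F) {f : E × ℝ →ₗ[ℝ] ℝ} (hf : ∀ u ∈ F, f (u, 1) = 0) (z : E × ℝ) :
    f z = coordFn τ v z * f (v, 1) := by
  conv_lhs => rw [← hτ.hbary_coord z]
  rw [map_hbary _ ((hτ.support_coord z).trans e.le), Finset.sum_insert hv,
    Finset.sum_eq_zero (s := F), add_zero, coordFn_apply]
  intro u hu
  rw [hf u hu, mul_zero]

lemma Crosses.exists_facet {X : E × ℝ} {τ' τ : Finset E} (h : L.Crosses X τ' τ) :
    ∃ (F : Finset E) (v v' : E), v ∉ F ∧ v' ∉ F ∧ v ≠ v' ∧ F.card = finrank ℝ E ∧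
      τ = insert v F ∧ τ' = insert v' F ∧ coordFn τ v X < 0 ∧ 0 < coordFn τ' v' X := by
  obtain ⟨hτ', hτ, hne, v, hv, hsub, hneg⟩ := h
  have hF : (τ.erase v).card = finrank ℝ E := by rw [Finset.card_erase_of_mem hv, hτ.2]; rfl
  have e : τ = insert v (τ.erase v) := (Finset.insert_erase hv).symm
  obtain ⟨v', hv', e'⟩ := hτ'.exists_insert hF hsub
  have hvv : v ≠ v' := by
    rintro rfl
    exact hne (e'.trans e.symm)
  refine ⟨τ.erase v, v, v', Finset.notMem_erase _ _, hv', hvv, hF, e, e', hneg, ?_⟩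
  have h1 := hτ.coordFn_neg hτ' e e' hv' hvv
  rw [hτ.coordFn_eq_mul hτ' e e' (Finset.notMem_erase _ _) hv'] at hneg
  exact pos_of_mul_neg_right hneg h1.le

/-- The functionals of `H` with the same sign on `τ` and at `X`. -/
noncomputable def sameSide (H : Finset (E × ℝ →ₗ[ℝ] ℝ)) (X : E × ℝ) (τ : Finset E) :
    Finset (E × ℝ →ₗ[ℝ] ℝ) :=
  H.filter fun f => ∀ u ∈ τ, 0 ≤ f X * f (u, 1)

variable {X : E × ℝ} {H : Finset (E × ℝ →ₗ[ℝ] ℝ)} {τ' τ : Finset E}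

lemma Crosses.sameSide_subset (h : L.Crosses X τ' τ) (hHX : ∀ f ∈ H, f X ≠ 0)
    (hH : ∀ f ∈ H, OneSided f τ') : sameSide H X τ ⊆ sameSide H X τ' := by
  obtain ⟨F, v, v', hv, hv', -, -, e, e', hneg, -⟩ := h.exists_facet
  intro f hf
  obtain ⟨hfH, hf⟩ := Finset.mem_filter.1 hf
  have hone : (∀ u ∈ τ', 0 ≤ f X * f (u, 1)) ∨ ∀ u ∈ τ', f X * f (u, 1) ≤ 0 := by
    rcases le_total 0 (f X) with h0 | h0 <;> rcases hH f hfH with h1 | h1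
    · exact .inl fun u hu => mul_nonneg h0 (h1 u hu)
    · exact .inr fun u hu => mul_nonpos_of_nonneg_of_nonpos h0 (h1 u hu)
    · exact .inr fun u hu => mul_nonpos_of_nonpos_of_nonneg h0 (h1 u hu)
    · exact .inl fun u hu => mul_nonneg_of_nonpos_of_nonpos h0 (h1 u hu)
  refine Finset.mem_filter.2 ⟨hfH, hone.resolve_right fun hle => ?_⟩
  have h0 : ∀ u ∈ F, f (u, 1) = 0 := fun u hu => by
    have h1 := hf u (e ▸ Finset.mem_insert_of_mem hu)
    have h2 := hle u (e' ▸ Finset.mem_insert_of_mem hu)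
    exact (mul_eq_zero.1 (le_antisymm h2 h1)).resolve_left (hHX f hfH)
  have h1 := h.2.1.apply_eq_mul hv e h0 X
  have h2 := hf v (e ▸ Finset.mem_insert_self _ _)
  have h3 : 0 < f X * f X := mul_self_pos.2 (hHX f hfH)
  have h4 : f X * f X = coordFn τ v X * (f X * f (v, 1)) := by
    linear_combination f X * h1
  exact h3.not_ge (h4 ▸ mul_nonpos_of_nonpos_of_nonneg hneg.le h2)

lemma Crosses.sameSide_ne (h : L.Crosses X τ' τ) {ρ' ρ : Finset E} (hρ' : K.IsTop ρ')
    (hρ : K.IsTop ρ) (hτρ' : convexHull ℝ (τ' : Set E) ⊆ convexHull ℝ (ρ' : Set E))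
    (hτρ : convexHull ℝ (τ : Set E) ⊆ convexHull ℝ (ρ : Set E)) (hne : ρ' ≠ ρ)
    (hK : ∀ v ∈ ρ, coordFn ρ v ∈ H) : sameSide H X τ ≠ sameSide H X τ' := by
  obtain ⟨F, v, v', hv, hv', -, -, e, e', hneg, hpos⟩ := h.exists_facet
  obtain ⟨v₀, hv₀, hv₀'⟩ := Finset.not_subset.1 fun hs : ρ ⊆ ρ' =>
    hne (Finset.eq_of_subset_of_card_le hs (by rw [hρ.2, hρ'.2])).symm
  have vert : ∀ {s : Finset E} {u}, u ∈ s → u ∈ convexHull ℝ (s : Set E) := fun hu =>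
    subset_convexHull ℝ _ (Finset.mem_coe.2 hu)
  have h0 : ∀ u ∈ F, coordFn ρ v₀ (u, 1) = 0 := fun u hu => by
    have hu' : u ∈ convexHull ℝ ((ρ ∩ ρ' : Finset E) : Set E) := by
      rw [Finset.coe_inter]
      exact K.inter_subset_convexHull hρ.1 hρ'.1
        ⟨hτρ (vert (e ▸ Finset.mem_insert_of_mem hu)), hτρ' (vert (e' ▸ Finset.mem_insert_of_mem hu))⟩
    refine map_eq_zero_of_mem_convexHull (fun y hy => ?_) hu'
    obtain ⟨h1, h2⟩ := Finset.mem_inter.1 hy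
    exact hρ.coordFn_of_ne h1 (by rintro rfl; exact hv₀' h2)
  have hvpos : 0 < coordFn ρ v₀ (v, 1) := by
    refine lt_of_le_of_ne (hρ.mem_convexHull_iff.1 (hτρ (vert (e ▸ Finset.mem_insert_self _ _))) v₀
      hv₀) fun hz => hρ.coordFn_ne_zero hv₀ (LinearMap.ext fun z => ?_)
    rw [h.2.1.apply_eq_mul hv e h0 z, ← hz, mul_zero, LinearMap.zero_apply]
  have hX : coordFn ρ v₀ X < 0 := by
    rw [h.2.1.apply_eq_mul hv e h0 X]
    exact mul_neg_of_neg_of_pos hneg hvpos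
  have hv'neg : coordFn ρ v₀ (v', 1) < 0 := by
    have hX' := hX
    rw [h.1.apply_eq_mul hv' e' h0 X] at hX'
    exact neg_of_mul_neg_right hX' hpos.le
  intro heq
  have hmem : coordFn ρ v₀ ∈ sameSide H X τ' := by
    refine Finset.mem_filter.2 ⟨hK v₀ hv₀, fun u hu => ?_⟩
    rw [e', Finset.mem_insert] at hu
    rcases hu with rfl | hu
    · exact (mul_pos_of_neg_of_neg hX hv'neg).le
    · rw [h0 u hu, mul_zero]
  rw [← heq] at hmem
  exact (mul_neg_of_neg_of_pos hX hvpos).not_ge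
    ((Finset.mem_filter.1 hmem).2 v (e ▸ Finset.mem_insert_self _ _))

/-- In an iterated derived subdivision fine enough for the hyperplanes spanned by the facets of the
original complex, the relation `Crosses` is acyclic. -/
lemma HasRootOrder.exists_order (h : K.HasRootOrder L X) (hHX : ∀ f ∈ H, f X ≠ 0)
    (hH : ∀ f ∈ H, ∀ A ∈ L.faces, OneSided f A)
    (hK : ∀ ρ, K.IsTop ρ → ∀ v ∈ ρ, coordFn ρ v ∈ H) :
    ∃ lt : Finset E → Finset E → Prop, (∀ τ, ¬ lt τ τ) ∧
      (∀ τ₁ τ₂ τ₃, lt τ₁ τ₂ → lt τ₂ τ₃ → lt τ₁ τ₃) ∧ ∀ τ' τ, L.Crosses X τ' τ → lt τ' τ := by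
  obtain ⟨root, lt, hirr, htr, hroot, hlt⟩ := h
  refine ⟨fun τ' τ => (sameSide H X τ).card < (sameSide H X τ').card ∨
    ((sameSide H X τ).card = (sameSide H X τ').card ∧ lt τ' τ), ?_, ?_, ?_⟩
  · rintro τ (h | h)
    exacts [lt_irrefl _ h, hirr _ h.2]
  · rintro τ₁ τ₂ τ₃ (h | h) (h' | h')
    · exact .inl (h'.trans h)
    · exact .inl (h'.1 ▸ h)
    · exact .inl (h.1 ▸ h')
    · exact .inr ⟨h'.1.trans h.1, htr _ _ _ h.2 h'.2⟩
  · intro τ' τ h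
    have hsub := h.sameSide_subset hHX fun f hf => hH f hf _ h.1.1
    by_cases hr : root τ' = root τ
    · exact (Finset.card_le_card hsub).lt_or_eq.imp_right fun he => ⟨he, hlt _ _ h hr⟩
    · exact .inl (Finset.card_lt_card (hsub.ssubset_of_ne
        (h.sameSide_ne (hroot _ h.1).1 (hroot _ h.2.1).1 (hroot _ h.1).2 (hroot _ h.2.1).2 hr
          (hK _ (hroot _ h.2.1).1))))

end Geometry.SimplicialComplex

end

section

open Module (finrank)
open Geometry.SimplicialComplex (IsTop Crosses)

variable [FiniteDimensional ℝ E] {L T : Geometry.SimplicialComplex ℝ E}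

/-- An affine dependency all of whose proper subfaces on the positive side occur in `T` determines
a bistellar move, provided its support contains a full-dimensional simplex. -/
lemma IsFlip.of_union_erase_mem {A B σ : Finset E} {ρ : E →₀ ℝ} (h0 : hbary ρ = 0)
    (hpos : ∀ v, 0 < ρ v ↔ v ∈ A) (hneg : ∀ v, ρ v < 0 ↔ v ∈ B) (hA : A.Nonempty)
    (hB : B.Nonempty) (hσ : L.IsTop σ) (hσAB : σ ⊆ A ∪ B)
    (hT : ∀ b ∈ B, A ∪ B.erase b ∈ T.faces) : IsFlip T A B ρ where
  hbary_eq := h0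
  pos_iff := hpos
  neg_iff := hneg
  nonempty := hB
  link C hC := by
    constructor
    · intro hG
      set p : E →₀ ℝ := Finsupp.indicator A fun v _ => ρ v with hp
      have hpA : ∀ v ∈ A, p v = ρ v := fun v hv => indicator_apply_mem _ hv
      have hpA' : ∀ v ∉ A, p v = 0 := fun v hv =>
        Finsupp.notMem_support_iff.1 fun h' => hv (support_indicator_subset' A _ h')
      set g : E →₀ ℝ := Finsupp.indicator (A ∪ C) fun _ _ => (1 : ℝ) with hg
      have hgG : ∀ v ∈ A ∪ C, g v = 1 := fun v hv => indicator_apply_mem _ hv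
      have hg0 : ∀ v, 0 ≤ g v := indicator_nonneg fun _ => zero_le_one
      have hgs : g.support ⊆ A ∪ C := support_indicator_subset' _ _
      have hp0 : ∀ v, 0 ≤ p v := fun v => by
        by_cases hv : v ∈ A
        · rw [hpA v hv]; exact ((hpos v).2 hv).le
        · rw [hpA' v hv]
      set w : E →₀ ℝ := p - (1 / 2 : ℝ) • ρ with hw
      have hwv : ∀ v, w v = |ρ v| / 2 := fun v => by
        simp only [hw, Finsupp.sub_apply, Finsupp.smul_apply, smul_eq_mul]
        by_cases hv : v ∈ A
        · rw [hpA v hv, abs_of_pos ((hpos v).2 hv)]; ring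
        · rw [hpA' v hv, abs_of_nonpos (not_lt.1 fun h' => hv ((hpos v).1 h'))]; ring
      have hwpos : ∀ v ∈ A ∪ B, 0 < w v := fun v hv => by
        rw [hwv]
        refine half_pos (abs_pos.2 ?_)
        rcases Finset.mem_union.1 hv with hv | hv
        exacts [((hpos v).2 hv).ne', ((hneg v).2 hv).ne]
      have hwsupp : ∀ v ∉ A ∪ B, w v = 0 := fun v hv => by
        rw [Finset.mem_union, not_or] at hv
        rw [hwv, le_antisymm (not_lt.1 fun h' => hv.1 ((hpos v).1 h'))
          (not_lt.1 fun h' => hv.2 ((hneg v).1 h')), abs_zero, zero_div]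
      set c := coord σ (hbary g) with hc
      have hcs : c.support ⊆ A ∪ B := (hσ.support_coord _).trans hσAB
      obtain ⟨ε, hε, hεpos⟩ : ∃ ε > (0 : ℝ), ∀ v ∈ A ∪ B, 0 < (w + ε • c) v := by
        have : ∀ᶠ ε : ℝ in nhds 0, ∀ v ∈ A ∪ B, 0 < (w + ε • c) v := by
          rw [Filter.eventually_all_finset]
          intro v hv
          have hcont : Continuous fun ε : ℝ => (w + ε • c) v := by
            simp only [Finsupp.add_apply, Finsupp.smul_apply, smul_eq_mul]
            fun_prop
          exact hcont.tendsto 0 |>.eventually_const_lt (by simpa using hwpos v hv)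
        obtain ⟨ε, h1, h2⟩ := ((this.filter_mono nhdsWithin_le_nhds).and
          (self_mem_nhdsWithin (s := Ioi (0 : ℝ)))).exists
        exact ⟨ε, h2, h1⟩
      have hzero : ∀ v ∉ A ∪ B, (w + ε • c) v = 0 := fun v hv => by
        rw [Finsupp.add_apply, hwsupp v hv, Finsupp.smul_apply,
          Finsupp.notMem_support_iff.1 fun h' => hv (hcs h'), smul_zero, add_zero]
      obtain ⟨t, ht, hu0, b, hb, hub⟩ := exists_slide (A := B) (w := w + ε • c) (ρ := -ρ) hB
        (fun v => by
          by_cases hv : v ∈ A ∪ B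
          exacts [(hεpos v hv).le, (hzero v hv).ge])
        (fun v => by simpa using hneg v)
        fun v hv => hεpos v (Finset.mem_union_right _ hv)
      have hus : (w + ε • c - t • -ρ).support ⊆ A ∪ B.erase b := by
        intro v hv
        have hvb : v ≠ b := by
          rintro rfl
          exact Finsupp.mem_support_iff.1 hv hub
        have hvAB : v ∈ A ∪ B := by
          by_contra hvAB
          refine Finsupp.mem_support_iff.1 hv ?_
          rw [Finsupp.sub_apply, hzero v hvAB, Finsupp.smul_apply, Finsupp.neg_apply]
          have := hwsupp v hvAB
          rw [hwv] at this
          have : |ρ v| = 0 := by linarith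
          rw [abs_eq_zero.1 this]
          simp
        rcases Finset.mem_union.1 hvAB with hv | hv
        exacts [Finset.mem_union_left _ hv,
          Finset.mem_union_right _ (Finset.mem_erase.2 ⟨hvb, hv⟩)]
      have key : p + ε • g = w + ε • c - t • -ρ := by
        refine T.eq_of_hbary_eq (fun v => ?_) hu0 hG (fun v hv => ?_) (hT b hb) hus ?_
        · exact add_nonneg (hp0 v) (mul_nonneg hε.le (hg0 v))
        · by_contra hvG
          refine Finsupp.mem_support_iff.1 hv ?_
          rw [Finsupp.add_apply, hpA' v fun h' => hvG (Finset.mem_union_left _ h'),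
            Finsupp.smul_apply, Finsupp.notMem_support_iff.1 fun h' => hvG (hgs h'), smul_zero,
            add_zero]
        · simp only [hw, map_add, map_sub, map_smul, map_neg, h0, hc, hσ.hbary_coord]
          simp
      have hCsub : C ⊆ B.erase b := fun v hv => by
        have hvA : v ∉ A := Finset.disjoint_right.1 hC hv
        have : v ∈ (p + ε • g).support := by
          rw [Finsupp.mem_support_iff, Finsupp.add_apply, hpA' v hvA, Finsupp.smul_apply,
            hgG v (Finset.mem_union_right _ hv)]
          simpa using hε.ne'
        rw [key] at this
        exact (Finset.mem_union.1 (hus this)).resolve_left hvA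
      exact hCsub.trans_ssubset (Finset.erase_ssubset hb)
    · intro hCB
      obtain ⟨b, hb, hbC⟩ := Finset.exists_of_ssubset hCB
      exact T.down_closed (hT b hb) (Finset.union_subset_union_right fun v hv =>
        Finset.mem_erase.2 ⟨by rintro rfl; exact hbC hv, hCB.1 hv⟩)
        (hA.mono Finset.subset_union_left)

end

section

open Module (finrank)

variable [FiniteDimensional ℝ E]

namespace Geometry.SimplicialComplex

/-- The point `x` is in general position with respect to the pure complex `L` and sees all
boundary facets of `L` from inside. -/
structure IsViewpoint (L : Geometry.SimplicialComplex ℝ E) (x : E) : Prop where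
  finrank_pos : 0 < finrank ℝ E
  exists_isTop : ∀ A ∈ L.faces, ∃ σ, L.IsTop σ ∧ A ⊆ σ
  ne_zero : ∀ σ, L.IsTop σ → ∀ v ∈ σ, coordFn σ v (x, 1) ≠ 0
  exists_neighbor : ∀ σ, L.IsTop σ → ∀ v ∈ σ, coordFn σ v (x, 1) < 0 →
    ∃ σ', L.IsTop σ' ∧ σ' ≠ σ ∧ σ.erase v ⊆ σ'

/-- The facets of the simplices in `D` visible from `x` through none of the simplices in `D`. -/
def frontFacets (x : E) (D : Finset (Finset E)) : Set (Finset E) :=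
  {F | (∃ σ ∈ D, ∃ v ∈ σ, F = σ.erase v) ∧
    ∀ σ ∈ D, ∀ v ∈ σ, F = σ.erase v → 0 < coordFn σ v (x, 1)}

/-- The complex `L` with the simplices in `D` replaced by the cones from `x` over their
front facets. -/
def swept (L : Geometry.SimplicialComplex ℝ E) (x : E) (D : Finset (Finset E)) :
    Set (Finset E) :=
  {s | s.Nonempty ∧ ((∃ σ, L.IsTop σ ∧ σ ∉ D ∧ s ⊆ σ) ∨ ∃ F ∈ frontFacets x D, s ⊆ insert x F)}

variable {L : Geometry.SimplicialComplex ℝ E} {x : E} {D : Finset (Finset E)} {σ : Finset E}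

namespace IsViewpoint

variable (hx : L.IsViewpoint x)
include hx

lemma notMem (hσ : L.IsTop σ) : x ∉ σ := fun hxσ => by
  obtain ⟨v, hv, hvx⟩ := Finset.exists_mem_ne (s := σ) (by
    have := hσ.2; have := hx.finrank_pos; omega) x
  exact hx.ne_zero σ hσ v hv (hσ.coordFn_of_ne hxσ hvx.symm)

lemma swept_empty : L.swept x ∅ = L.faces := by
  ext s
  constructor
  · rintro ⟨hs, ⟨σ, hσ, -, hsσ⟩ | ⟨F, ⟨⟨σ, hσ, -⟩, -⟩, -⟩⟩
    · exact L.down_closed hσ.1 hsσ hs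
    · simp at hσ
  · intro hs
    obtain ⟨σ, hσ, hsσ⟩ := hx.exists_isTop s hs
    exact ⟨L.nonempty_of_mem_faces hs, .inl ⟨σ, hσ, by simp, hsσ⟩⟩

variable (hD : ∀ τ ∈ D, L.IsTop τ) (hσ : L.IsTop σ) (hσD : σ ∉ D)
  (hσc : ∀ τ', L.Crosses (x, 1) τ' σ → τ' ∈ D)
include hD hσ hσD hσc

lemma erase_mem_frontFacets {v : E} (hv : v ∈ σ) (hneg : coordFn σ v (x, 1) < 0) :
    σ.erase v ∈ frontFacets x D := by
  obtain ⟨σ', hσ', hne, hsub⟩ := hx.exists_neighbor σ hσ v hv hneg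
  have hc : L.Crosses (x, 1) σ' σ := ⟨hσ', hσ, hne, v, hv, hsub, hneg⟩
  have hσ'D := hσc σ' hc
  have hF : (σ.erase v).card = finrank ℝ E := by rw [Finset.card_erase_of_mem hv, hσ.2]; rfl
  have e : σ = insert v (σ.erase v) := (Finset.insert_erase hv).symm
  have hvF := Finset.notMem_erase v σ
  obtain ⟨v', hv', e'⟩ := hσ'.exists_insert hF hsub
  refine ⟨⟨σ', hσ'D, v', e' ▸ Finset.mem_insert_self _ _, ?_⟩, fun τ hτ u hu he => ?_⟩
  · rw [e', Finset.erase_insert hv']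
  · have heq : τ = σ' := ((hσ.eq_or_eq hσ' (hD τ hτ) hF (Finset.erase_subset _ _) hsub
      (he ▸ Finset.erase_subset _ _) hne.symm).resolve_left (by rintro rfl; exact hσD hτ))
    subst heq
    have huF : u ∉ σ.erase v := he ▸ Finset.notMem_erase u τ
    have eu : τ = insert u (σ.erase v) := by rw [he, Finset.insert_erase hu]
    have hvu : v ≠ u := by
      rintro rfl
      exact hne (eu.trans e.symm)
    have h1 := hσ.coordFn_neg hσ' e eu huF hvu
    rw [hσ.coordFn_eq_mul hσ' e eu hvF huF] at hneg
    exact pos_of_mul_neg_right hneg h1.le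

variable (hDc : ∀ τ' τ, L.Crosses (x, 1) τ' τ → τ ∈ D → τ' ∈ D)
include hDc

lemma mem_frontFacets_insert (F : Finset E) : F ∈ frontFacets x (insert σ D) ↔
    (∃ v ∈ σ, 0 < coordFn σ v (x, 1) ∧ F = σ.erase v) ∨
      (F ∈ frontFacets x D ∧ ∀ v ∈ σ, coordFn σ v (x, 1) < 0 → F ≠ σ.erase v) := by
  constructor
  · rintro ⟨⟨τ, hτ, v, hv, e⟩, hF⟩
    rcases Finset.mem_insert.1 hτ with rfl | hτ
    · exact .inl ⟨v, hv, hF τ (Finset.mem_insert_self _ _) v hv e, e⟩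
    · exact .inr ⟨⟨⟨τ, hτ, v, hv, e⟩, fun τ' hτ' => hF τ' (Finset.mem_insert_of_mem hτ')⟩,
        fun u hu hneg e' => hneg.not_gt (hF σ (Finset.mem_insert_self _ _) u hu e')⟩
  · rintro (⟨v, hv, hpos, rfl⟩ | ⟨⟨⟨τ, hτ, v, hv, e⟩, hF⟩, hne⟩)
    · refine ⟨⟨σ, Finset.mem_insert_self _ _, v, hv, rfl⟩, fun τ hτ u hu e => ?_⟩
      rcases Finset.mem_insert.1 hτ with rfl | hτ
      · rwa [← (Finset.erase_injOn _ hv hu e : v = u)]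
      · by_contra hneg
        have hneg := lt_of_le_of_ne (not_lt.1 hneg) (hx.ne_zero τ (hD τ hτ) u hu)
        exact hσD (hDc σ τ ⟨hσ, hD τ hτ, by rintro rfl; exact hσD hτ, u, hu,
          e ▸ Finset.erase_subset _ _, hneg⟩ hτ)
    · refine ⟨⟨τ, Finset.mem_insert_of_mem hτ, v, hv, e⟩, fun τ' hτ' u hu e' => ?_⟩
      rcases Finset.mem_insert.1 hτ' with rfl | hτ'
      · exact lt_of_le_of_ne (not_lt.1 fun h => hne u hu h e') (hx.ne_zero τ' hσ u hu).symm
      · exact hF τ' hτ' u hu e'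

/-- Sweeping one more simplex is a bistellar move. -/
lemma exists_flip {T : Geometry.SimplicialComplex ℝ E} (hT : T.faces = L.swept x D) :
    ∃ (A B : Finset E) (ρ : E →₀ ℝ) (h : IsFlip T A B ρ),
      A.card + B.card = finrank ℝ E + 2 ∧ h.move.faces = L.swept x (insert σ D) := by
  have hxσ := hx.notMem hσ
  set A := σ.filter fun v => 0 < coordFn σ v (x, 1) with hA
  set N := σ.filter fun v => coordFn σ v (x, 1) < 0 with hN
  have hAN : ∀ v, v ∈ σ ↔ v ∈ A ∨ v ∈ N := fun v => by
    simp only [hA, hN, Finset.mem_filter, ← and_or_left]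
    exact ⟨fun hv => ⟨hv, (hx.ne_zero σ hσ v hv).lt_or_gt.symm⟩, fun h => h.1⟩
  have hAσ : A ⊆ σ := Finset.filter_subset _ _
  have hNσ : N ⊆ σ := Finset.filter_subset _ _
  have hANd : Disjoint A N := Finset.disjoint_left.2 fun v h1 h2 =>
    (Finset.mem_filter.1 h1).2.not_gt (Finset.mem_filter.1 h2).2
  have hxA : x ∉ A := fun h => hxσ (hAσ h)
  have hxN : x ∉ N := fun h => hxσ (hNσ h)
  set B := insert x N with hB
  have hcx : coord σ (x, 1) x = 0 := hσ.coordFn_of_notMem hxσ _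
  set ρ : E →₀ ℝ := coord σ (x, 1) - Finsupp.single x 1 with hρ
  have hρx : ρ x = -1 := by simp [hρ, hcx]
  have hρv : ∀ v ≠ x, ρ v = coordFn σ v (x, 1) := fun v hv => by
    simp [hρ, coordFn_apply, Finsupp.single_eq_of_ne hv]
  have hpos : ∀ v, 0 < ρ v ↔ v ∈ A := fun v => by
    by_cases hv : v = x
    · subst hv
      simp only [hρx, hxA, iff_false]
      norm_num
    · rw [hρv v hv, hA, Finset.mem_filter]
      exact ⟨fun h => ⟨by_contra fun hvσ => h.ne' (hσ.coordFn_of_notMem hvσ _), h⟩, fun h => h.2⟩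
  have hneg : ∀ v, ρ v < 0 ↔ v ∈ B := fun v => by
    by_cases hv : v = x
    · subst hv
      simp [hρx, hB]
    · rw [hρv v hv, hB, Finset.mem_insert, hN, Finset.mem_filter]
      exact ⟨fun h => .inr ⟨by_contra fun hvσ => h.ne (hσ.coordFn_of_notMem hvσ _), h⟩,
        fun h => (h.resolve_left hv).2⟩
  have hAne : A.Nonempty := by
    by_contra hAe
    rw [Finset.not_nonempty_iff_eq_empty] at hAe
    have h1 := congrArg Prod.snd (hσ.hbary_coord (x, 1))
    have h2 := map_hbary (LinearMap.snd ℝ E ℝ) (hσ.support_coord (x, 1))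
    simp only [LinearMap.snd_apply, mul_one] at h2
    rw [h2] at h1
    have h3 : ∑ v ∈ σ, coord σ (x, 1) v ≤ 0 := Finset.sum_nonpos fun v hv =>
      not_lt.1 fun h => Finset.notMem_empty v
        (hAe ▸ Finset.mem_filter.2 (show v ∈ σ ∧ 0 < coordFn σ v (x, 1) from ⟨hv, h⟩))
    simp only at h1
    linarith
  have hfl : IsFlip T A B ρ := by
    refine .of_union_erase_mem ?_ hpos hneg hAne (Finset.insert_nonempty _ _) hσ (fun v hv => ?_)
      fun b hb => ?_
    · rw [hρ, map_sub, hσ.hbary_coord, hbary_single, one_smul, sub_self]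
    · rcases (hAN v).1 hv with h | h
      exacts [Finset.mem_union_left _ h, Finset.mem_union_right _ (Finset.mem_insert_of_mem h)]
    · rw [hT]
      refine ⟨hAne.mono Finset.subset_union_left, ?_⟩
      rcases Finset.mem_insert.1 hb with rfl | hb
      · refine .inl ⟨σ, hσ, hσD, Finset.union_subset hAσ ?_⟩
        rw [hB, Finset.erase_insert hxN]
        exact hNσ
      · refine .inr ⟨σ.erase b, hx.erase_mem_frontFacets hD hσ hσD hσc (hNσ hb)
          (Finset.mem_filter.1 hb).2, fun v hv => ?_⟩
        rw [Finset.mem_insert, Finset.mem_erase]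
        rcases Finset.mem_union.1 hv with hvA | hvB
        · exact .inr ⟨by rintro rfl; exact Finset.disjoint_left.1 hANd hvA hb, hAσ hvA⟩
        · obtain ⟨h1, h2⟩ := Finset.mem_erase.1 hvB
          exact (Finset.mem_insert.1 h2).imp_right fun h => ⟨h1, hNσ h⟩
  have hcard : A.card + B.card = finrank ℝ E + 2 := by
    have : σ = A ∪ N := by
      ext v
      rw [hAN, Finset.mem_union]
    rw [hB, Finset.card_insert_of_notMem hxN, ← add_assoc, ← Finset.card_union_of_disjoint hANd,
      ← this, hσ.2]
  have hfront := hx.mem_frontFacets_insert hD hσ hσD hσc hDc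
  have hcone : ∀ {s a}, a ∈ A → a ∉ s → s ⊆ insert x σ →
      ∃ F ∈ frontFacets x (insert σ D), s ⊆ insert x F := fun {s a} ha has hs =>
    ⟨σ.erase a, (hfront _).2 (.inl ⟨a, hAσ ha, (Finset.mem_filter.1 ha).2, rfl⟩), fun v hv => by
      rw [Finset.mem_insert, Finset.mem_erase]
      exact (Finset.mem_insert.1 (hs hv)).imp_right fun h => ⟨by rintro rfl; exact has hv, h⟩⟩
  have hstar : ∀ {s}, s ∈ T.faces → A ⊆ s → s ⊆ insert x σ := fun {s} hs hAs v hv => by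
    by_cases hvA : v ∈ A
    · exact Finset.mem_insert_of_mem (hAσ hvA)
    · have := (hfl.sdiff_ssubset hs hAs).1 (Finset.mem_sdiff.2 ⟨hv, hvA⟩)
      exact Finset.insert_subset_insert x hNσ this
  refine ⟨A, B, ρ, hfl, hcard, ?_⟩
  rw [hfl.faces_move]
  ext s
  constructor
  · rintro (⟨hs, hAs⟩ | ⟨A', hA', rfl⟩)
    · obtain ⟨a, ha, has⟩ := Finset.not_subset.1 hAs
      refine ⟨T.nonempty_of_mem_faces hs, ?_⟩
      rw [hT] at hs
      rcases hs.2 with ⟨τ, hτ, hτD, hsτ⟩ | ⟨F, hF, hsF⟩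
      · by_cases hτσ : τ = σ
        · subst hτσ
          exact .inr (hcone ha has (hsτ.trans (Finset.subset_insert _ _)))
        · exact .inl ⟨τ, hτ, by simp [hτσ, hτD], hsτ⟩
      · right
        by_cases hFσ : ∃ v ∈ σ, coordFn σ v (x, 1) < 0 ∧ F = σ.erase v
        · obtain ⟨v, -, -, rfl⟩ := hFσ
          exact hcone ha has (hsF.trans (Finset.insert_subset_insert _ (Finset.erase_subset _ _)))
        · push Not at hFσ
          exact ⟨F, (hfront F).2 (.inr ⟨hF, hFσ⟩), hsF⟩
    · obtain ⟨a, ha, haA'⟩ := Finset.exists_of_ssubset hA'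
      refine ⟨(Finset.insert_nonempty x N).mono Finset.subset_union_right, .inr (hcone ha ?_ ?_)⟩
      · rw [Finset.mem_union, not_or, Finset.mem_insert, not_or]
        exact ⟨haA', by rintro rfl; exact hxA ha, Finset.disjoint_left.1 hANd ha⟩
      · exact Finset.union_subset ((hA'.1.trans hAσ).trans (Finset.subset_insert _ _))
          (Finset.insert_subset_insert x hNσ)
  · rintro ⟨hsne, ⟨τ, hτ, hτD, hsτ⟩ | ⟨F, hF, hsF⟩⟩
    · rw [Finset.mem_insert, not_or] at hτD
      have hτT : τ ∈ T.faces := by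
        rw [hT]
        exact ⟨L.nonempty_of_mem_faces hτ.1, .inl ⟨τ, hτ, hτD.2, subset_rfl⟩⟩
      refine .inl ⟨T.down_closed hτT hsτ hsne, fun hAs => hτD.1 ?_⟩
      refine Finset.eq_of_subset_of_card_le (fun v hv => ?_) (by rw [hτ.2, hσ.2])
      exact (Finset.mem_insert.1 (hstar hτT (hAs.trans hsτ) hv)).resolve_left
        (by rintro rfl; exact hx.notMem hτ hv)
    · rcases (hfront F).1 hF with ⟨a, ha, hapos, rfl⟩ | ⟨hFD, hFσ⟩
      · have haA : a ∈ A := Finset.mem_filter.2 ⟨ha, hapos⟩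
        have has : a ∉ s := fun h => by
          rcases Finset.mem_insert.1 (hsF h) with rfl | h
          exacts [hxσ ha, Finset.notMem_erase _ _ h]
        have hsAB : s ⊆ A ∪ B := fun v hv => by
          rcases Finset.mem_insert.1 (hsF hv) with rfl | h
          · exact Finset.mem_union_right _ (Finset.mem_insert_self _ _)
          · rcases (hAN v).1 (Finset.mem_of_mem_erase h) with h | h
            exacts [Finset.mem_union_left _ h, Finset.mem_union_right _ (Finset.mem_insert_of_mem h)]
        by_cases hBs : B ⊆ s
        · refine .inr ⟨s ∩ A, ⟨Finset.inter_subset_right, fun h =>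
            has (Finset.mem_inter.1 (h haA)).1⟩, ?_⟩
          ext v
          rw [Finset.mem_union, Finset.mem_inter]
          exact ⟨fun hv => (Finset.mem_union.1 (hsAB hv)).imp_left fun h => ⟨hv, h⟩,
            fun h => h.elim (fun h => h.1) fun h => hBs h⟩
        · obtain ⟨b, hb, hbs⟩ := Finset.not_subset.1 hBs
          refine .inl ⟨?_, fun hAs => has (hAs haA)⟩
          refine T.down_closed ((hfl.link (B.erase b) ?_).2 (Finset.erase_ssubset hb))
            (fun v hv => ?_) hsne
          · exact hfl.disjoint.mono_right (Finset.erase_subset _ _)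
          · rcases Finset.mem_union.1 (hsAB hv) with h | h
            · exact Finset.mem_union_left _ h
            · exact Finset.mem_union_right _
                (Finset.mem_erase.2 ⟨by rintro rfl; exact hbs hv, h⟩)
      · have hxF : x ∉ F := by
          obtain ⟨⟨τ, hτ, v, -, rfl⟩, -⟩ := hFD
          exact fun h => hx.notMem (hD τ hτ) (Finset.mem_of_mem_erase h)
        have hFc : F.card = finrank ℝ E := by
          obtain ⟨⟨τ, hτ, v, hv, rfl⟩, -⟩ := hFD
          rw [Finset.card_erase_of_mem hv, (hD τ hτ).2]
          rfl
        have hG : insert x F ∈ T.faces := by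
          rw [hT]
          exact ⟨Finset.insert_nonempty _ _, .inr ⟨F, hFD, subset_rfl⟩⟩
        refine .inl ⟨T.down_closed hG hsF hsne, fun hAs => ?_⟩
        have hAF : A ⊆ F := fun a ha =>
          (Finset.mem_insert.1 (hsF (hAs ha))).resolve_left (by rintro rfl; exact hxA ha)
        have hFsub : F ⊆ σ := fun v hv =>
          (Finset.mem_insert.1 (hstar hG (hAs.trans hsF) (Finset.mem_insert_of_mem hv))).resolve_left
            (by rintro rfl; exact hxF hv)
        obtain ⟨v, hv, e⟩ := hσ.exists_insert hFc hFsub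
        have hvσ : v ∈ σ := e ▸ Finset.mem_insert_self _ _
        refine hFσ v hvσ ?_ (by rw [e, Finset.erase_insert hv])
        exact (Finset.mem_filter.1 (((hAN v).1 hvσ).resolve_left fun h => hv (hAF h))).2

end IsViewpoint

end Geometry.SimplicialComplex

end

section

open Module (finrank)

lemma StrictlyStarConvex.subset_closure_interior {P : Set E} (h : StrictlyStarConvex P) :
    P ⊆ closure (interior P) := by
  obtain ⟨x, -, hx⟩ := h
  intro y hy
  have hc : Filter.Tendsto (fun t : ℝ => (1 - t) • x + t • y) (nhds 1) (nhds y) := by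
    have : Continuous fun t : ℝ => (1 - t) • x + t • y := by fun_prop
    simpa using this.tendsto 1
  refine mem_closure_of_tendsto (hc.mono_left (nhdsWithin_le_nhds (s := Iio 1))) ?_
  filter_upwards [Ioo_mem_nhdsLT (zero_lt_one' ℝ)] with t ht
  exact hx y hy t ht

namespace Geometry.SimplicialComplex

variable {L : Geometry.SimplicialComplex ℝ E} (hL : L.faces.Finite)

/-- The full-dimensional simplices of a finite complex. -/
noncomputable def tops : Finset (Finset E) := hL.toFinset.filter L.IsTop

lemma mem_tops {σ : Finset E} : σ ∈ tops hL ↔ L.IsTop σ := by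
  rw [tops, Finset.mem_filter, Set.Finite.mem_toFinset]
  exact ⟨fun h => h.2, fun h => ⟨h.1, h⟩⟩

variable [FiniteDimensional ℝ E]

/-- The barycentric coordinate functionals of the full-dimensional simplices. -/
noncomputable def coordFns : Finset (E × ℝ →ₗ[ℝ] ℝ) :=
  (tops hL).biUnion fun σ => σ.image (coordFn σ)

variable {hL}

lemma IsTop.mem_coordFns {σ : Finset E} (hσ : L.IsTop σ) {v : E} (hv : v ∈ σ) :
    coordFn σ v ∈ coordFns hL :=
  Finset.mem_biUnion.2 ⟨σ, (mem_tops hL).2 hσ, Finset.mem_image_of_mem _ hv⟩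

lemma ne_zero_of_mem_coordFns {f : E × ℝ →ₗ[ℝ] ℝ} (hf : f ∈ coordFns hL) : f ≠ 0 := by
  obtain ⟨σ, hσ, h⟩ := Finset.mem_biUnion.1 hf
  obtain ⟨v, hv, rfl⟩ := Finset.mem_image.1 h
  exact ((mem_tops hL).1 hσ).coordFn_ne_zero hv

variable (hL)

lemma eventually_coordFn_pos (hcl : L.space ⊆ closure (interior L.space)) {x : E}
    (hd : 0 < finrank ℝ E)
    (hx : ∀ y ∈ L.space, ∀ t ∈ Set.Ioo (0 : ℝ) 1, (1 - t) • x + t • y ∈ interior L.space) :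
    ∀ᶠ y in nhds x, ∀ σ ∈ tops hL, ∀ v ∈ σ,
      convexHull ℝ (σ.erase v : Set E) ⊆ frontier L.space → 0 < coordFn σ v (y, 1) := by
  rw [Filter.eventually_all_finset]
  intro σ hσ
  rw [Filter.eventually_all_finset]
  intro v hv
  rw [mem_tops] at hσ
  by_cases hfr : convexHull ℝ (σ.erase v : Set E) ⊆ frontier L.space
  · have hF := hσ.erase_mem hd hv
    have hpos := hσ.coordFn_center_pos hL hcl hx hF.2 (L.nonempty_of_mem_faces hF.1)
      (Finset.notMem_erase v σ) (Finset.insert_erase hv).symm hfr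
    filter_upwards [((continuous_coordFn σ v).tendsto x).eventually_const_lt hpos] with y hy _
    exact hy
  · exact .of_forall fun y h => absurd h hfr

lemma isViewpoint (hcl : L.space ⊆ closure (interior L.space)) (hd : 0 < finrank ℝ E) {x : E}
    (hne : ∀ f ∈ coordFns hL, f (x, 1) ≠ 0)
    (hpos : ∀ σ ∈ tops hL, ∀ v ∈ σ,
      convexHull ℝ (σ.erase v : Set E) ⊆ frontier L.space → 0 < coordFn σ v (x, 1)) :
    L.IsViewpoint x where
  finrank_pos := hd
  exists_isTop _ hA := exists_isTop_superset hL hcl hA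
  ne_zero _ hσ _ hv := hne _ (hσ.mem_coordFns hv)
  exists_neighbor σ hσ v hv hneg := by
    by_contra! hcon
    have hF := hσ.erase_mem hd hv
    refine hneg.not_gt (hpos σ ((mem_tops hL).2 hσ) v hv ?_)
    exact hσ.subset_frontier_of_unique hL hcl hF.2 (L.nonempty_of_mem_faces hF.1)
      (Finset.erase_subset _ _) fun σ' hσ' h => by_contra fun hne => hcon σ' hσ' hne h

variable {hL}

lemma IsViewpoint.mem_frontFacets_tops {x : E} (hx : L.IsViewpoint x)
    (hcl : L.space ⊆ closure (interior L.space)) (F : Finset E) :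
    F ∈ frontFacets x (tops hL) ↔ F ∈ L.boundaryFaces ∧ F.card = finrank ℝ E := by
  constructor
  · rintro ⟨⟨σ, hσ, v, hv, rfl⟩, hF⟩
    have hσ' := (mem_tops hL).1 hσ
    obtain ⟨hFL, hFc⟩ := hσ'.erase_mem hx.finrank_pos hv
    refine ⟨⟨hFL, hσ'.subset_frontier_of_unique hL hcl hFc (L.nonempty_of_mem_faces hFL)
      (Finset.erase_subset _ _) fun τ hτ hFτ => ?_⟩, hFc⟩
    obtain ⟨u, hu, e⟩ := hτ.exists_insert hFc hFτ
    have e' := (Finset.insert_erase hv).symm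
    by_contra hne
    have hvu : v ≠ u := by rintro rfl; exact hne (e.trans e'.symm)
    have h1 := hF σ hσ v hv rfl
    have h2 := hF τ ((mem_tops hL).2 hτ) u (e ▸ Finset.mem_insert_self _ _)
      (by rw [e, Finset.erase_insert hu])
    have h3 := hσ'.coordFn_neg hτ e' e hu hvu
    rw [hσ'.coordFn_eq_mul hτ e' e (Finset.notMem_erase _ _) hu] at h1
    exact h1.not_gt (mul_neg_of_neg_of_pos h3 h2)
  · rintro ⟨⟨hFL, hfr⟩, hFc⟩
    have hF0 := L.nonempty_of_mem_faces hFL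
    obtain ⟨σ, hσ, hFσ⟩ := hx.exists_isTop F hFL
    obtain ⟨v, hv, e⟩ := hσ.exists_insert hFc hFσ
    refine ⟨⟨σ, (mem_tops hL).2 hσ, v, e ▸ Finset.mem_insert_self _ _,
      by rw [e, Finset.erase_insert hv]⟩, fun τ hτ u hu e' => ?_⟩
    rw [mem_tops] at hτ
    by_contra hneg
    obtain ⟨τ', hτ', hne, hsub⟩ := hx.exists_neighbor τ hτ u hu
      (lt_of_le_of_ne (not_lt.1 hneg) (hx.ne_zero τ hτ u hu))
    exact hne (hτ'.eq_of_subset_frontier hτ hFc hF0 (e' ▸ hsub) (e' ▸ Finset.erase_subset _ _) hfr)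

/-- A complex can be swept from a viewpoint as soon as the relation `Crosses` is acyclic. -/
lemma IsViewpoint.exists_sweep {x : E} (hx : L.IsViewpoint x)
    (hlt : ∃ lt : Finset E → Finset E → Prop, (∀ τ, ¬ lt τ τ) ∧
      (∀ τ₁ τ₂ τ₃, lt τ₁ τ₂ → lt τ₂ τ₃ → lt τ₁ τ₃) ∧ ∀ τ' τ, L.Crosses (x, 1) τ' τ → lt τ' τ) :
    ∃ T : Geometry.SimplicialComplex ℝ E, T.faces = L.swept x (tops hL) ∧
      Relation.ReflTransGen (BistellarMove (finrank ℝ E)) L T ∧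
      Relation.ReflTransGen (BistellarMove (finrank ℝ E)) T L := by
  obtain ⟨lt, hirr, htr, hlt⟩ := hlt
  let good : Finset (Finset E) → Prop := fun D =>
    (∀ τ' τ, L.Crosses (x, 1) τ' τ → τ ∈ D → τ' ∈ D) ∧
    ∃ T : Geometry.SimplicialComplex ℝ E, T.faces = L.swept x D ∧
      Relation.ReflTransGen (BistellarMove (finrank ℝ E)) L T ∧
      Relation.ReflTransGen (BistellarMove (finrank ℝ E)) T L
  have hempty : good ∅ := ⟨by simp, L, hx.swept_empty.symm, .refl, .refl⟩
  obtain ⟨D, hDmem, hmax⟩ := ((tops hL).powerset.filter good).exists_max_image Finset.card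
    ⟨∅, Finset.mem_filter.2 ⟨Finset.empty_mem_powerset _, hempty⟩⟩
  obtain ⟨hDsub, hDc, T, hT, h1, h2⟩ := Finset.mem_filter.1 hDmem
  rw [Finset.mem_powerset] at hDsub
  suffices D = tops hL by subst this; exact ⟨T, hT, h1, h2⟩
  by_contra hne
  have : IsStrictOrder (Finset E) lt := { irrefl := hirr, trans := htr }
  obtain ⟨σ₀, hσ₀, hσ₀D⟩ := Finset.exists_of_ssubset (hDsub.ssubset_of_ne hne)
  obtain ⟨⟨σ, hσmem⟩, -, hmin⟩ := ((tops hL \ D).finite_toSet.wellFoundedOn (r := lt)).has_min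
    Set.univ ⟨⟨σ₀, by simp [hσ₀, hσ₀D]⟩, trivial⟩
  obtain ⟨hσ, hσD⟩ := Finset.mem_sdiff.1 (Finset.mem_coe.1 hσmem)
  have hσc : ∀ τ', L.Crosses (x, 1) τ' σ → τ' ∈ D := fun τ' hτ' => by
    by_contra hτ'D
    exact hmin ⟨τ', by simp [(mem_tops hL).2 hτ'.1, hτ'D]⟩ trivial (hlt _ _ hτ')
  obtain ⟨A, B, ρ, h, hcard, hfaces⟩ := hx.exists_flip (fun τ hτ => (mem_tops hL).1 (hDsub hτ))
    ((mem_tops hL).1 hσ) hσD hσc hDc hT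
  have hgood : good (insert σ D) := by
    refine ⟨fun τ' τ hc hτ => Finset.mem_insert_of_mem ?_, h.move, hfaces,
      h1.tail (h.bistellarMove hcard), h2.head (h.bistellarMove_symm hcard)⟩
    rcases Finset.mem_insert.1 hτ with rfl | hτ
    exacts [hσc τ' hc, hDc τ' τ hc hτ]
  have := hmax (insert σ D) (Finset.mem_filter.2
    ⟨Finset.mem_powerset.2 (Finset.insert_subset hσ hDsub), hgood⟩)
  rw [Finset.card_insert_of_notMem hσD] at this
  omega

end Geometry.SimplicialComplex

open Geometry.SimplicialComplex in
/-- Two triangulations of a strictly star-convex set with the same boundary have iterated derived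
subdivisions with the same boundary related by bistellar moves. -/
theorem exists_isIterDerived_reflTransGen_bistellarMove [FiniteDimensional ℝ E]
    (hd : 0 < finrank ℝ E) {K₁ K₂ : Geometry.SimplicialComplex ℝ E} (hK₁ : K₁.faces.Finite)
    (hK₂ : K₂.faces.Finite) (hK : K₁.space = K₂.space) (hstar : StrictlyStarConvex K₁.space)
    (hbd : K₁.boundaryFaces = K₂.boundaryFaces) :
    ∃ (s : ℕ) (B₁ B₂ : Geometry.SimplicialComplex ℝ E), IsIterDerived s B₁ K₁ ∧
      IsIterDerived s B₂ K₂ ∧ B₁.space = K₁.space ∧ B₂.space = K₁.space ∧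
      B₁.boundaryFaces = B₂.boundaryFaces ∧
      Relation.ReflTransGen (BistellarMove (finrank ℝ E)) B₁ B₂ := by
  obtain ⟨B₁, B₂, i₁, i₂, d₁, d₂, f₁, f₂, s₁, s₂, hb, hl⟩ :=
    exists_oneSided_derived (coordFns hK₁ ∪ coordFns hK₂).toList hK₁ hK₂ hK hbd
  rw [← hK] at s₂
  refine ⟨_, B₁, B₂, i₁, i₂, s₁, s₂, hb, ?_⟩
  have hcl := hstar.subset_closure_interior
  obtain ⟨c, -, hc⟩ := hstar
  obtain ⟨U, hU, hUo, hcU⟩ := eventually_nhds_iff.1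
    ((eventually_coordFn_pos f₁ (s₁.symm ▸ hcl) hd (s₁.symm ▸ hc)).and
      (eventually_coordFn_pos f₂ (s₂.symm ▸ hcl) hd (s₂.symm ▸ hc)))
  obtain ⟨x, hxU, hx⟩ := exists_generic hUo ⟨c, hcU⟩
    (coordFns hK₁ ∪ coordFns hK₂ ∪ coordFns f₁ ∪ coordFns f₂) (by
      simp only [Finset.mem_union]
      rintro f (((h | h) | h) | h) <;> exact ne_zero_of_mem_coordFns h)
  simp only [Finset.mem_union] at hx
  have v₁ := isViewpoint f₁ (s₁.symm ▸ hcl) hd (fun f hf => hx f (.inl (.inr hf))) (hU x hxU).1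
  have v₂ := isViewpoint f₂ (s₂.symm ▸ hcl) hd (fun f hf => hx f (.inr hf)) (hU x hxU).2
  obtain ⟨T₁, hT₁, h₁, -⟩ := v₁.exists_sweep (hL := f₁) ((d₁.hasRootOrder hd (x, 1)).exists_order
    (H := coordFns hK₁) (fun f hf => hx f (.inl (.inl (.inl hf))))
    (fun f hf => (hl f (by simp [hf])).1) fun ρ hρ v hv => hρ.mem_coordFns hv)
  obtain ⟨T₂, hT₂, -, h₂⟩ := v₂.exists_sweep (hL := f₂) ((d₂.hasRootOrder hd (x, 1)).exists_order
    (H := coordFns hK₂) (fun f hf => hx f (.inl (.inl (.inr hf))))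
    (fun f hf => (hl f (by simp [hf])).2) fun ρ hρ v hv => hρ.mem_coordFns hv)
  have hTT : T₁ = T₂ := by
    ext s
    rw [hT₁, hT₂]
    refine and_congr_right fun _ => or_congr ?_ (exists_congr fun F => and_congr_left fun _ => ?_)
    · exact ⟨fun ⟨σ, hσ, h, _⟩ => absurd ((mem_tops f₁).2 hσ) h,
        fun ⟨σ, hσ, h, _⟩ => absurd ((mem_tops f₂).2 hσ) h⟩
    · rw [v₁.mem_frontFacets_tops (s₁.symm ▸ hcl), v₂.mem_frontFacets_tops (s₂.symm ▸ hcl), hb]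
  exact h₁.trans (hTT ▸ h₂)

end

lemma Geometry.SimplicialComplex.eq_of_subsingleton [Subsingleton E]
    {K L : Geometry.SimplicialComplex ℝ E} (hK : K.space.Nonempty) (hL : L.space.Nonempty) :
    K = L := by
  have key : ∀ M : Geometry.SimplicialComplex ℝ E, M.space.Nonempty → M.faces = {{0}} := by
    intro M ⟨x, hx⟩
    have h : ∀ s ∈ M.faces, s = {0} := fun s hs => by
      obtain ⟨y, hy⟩ := M.nonempty_of_mem_faces hs
      exact Finset.eq_singleton_iff_unique_mem.2
        ⟨Subsingleton.elim y 0 ▸ hy, fun z _ => Subsingleton.elim z 0⟩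
    obtain ⟨s, hs, -⟩ := mem_space_iff.1 hx
    exact Set.Subset.antisymm h (Set.singleton_subset_iff.2 (h s hs ▸ hs))
  ext1
  rw [key K hK, key L hL]

/-- Let `P ⊂ ℝⁿ` be a flat (full-dimensional) compact polyhedron which is
strictly star-convex, and let `K₁`, `K₂` be simplicial triangulations of `P` inducing the same
triangulation of the boundary `∂P`. Then there are `s ∈ ℕ` and `s`-fold derived subdivisions
`βˢK₁`, `βˢK₂` which still agree on `∂P` and are bistellar equivalent. -/
theorem statement0 {n : ℕ} (P : Set (Fin n → ℝ))
    (hPcompact : IsCompact P) (hPflat : (interior P).Nonempty)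
    (hPstar : StrictlyStarConvex P)
    (K₁ K₂ : Geometry.SimplicialComplex ℝ (Fin n → ℝ))
    (hK₁fin : K₁.faces.Finite) (hK₂fin : K₂.faces.Finite)
    (hK₁ : K₁.space = P) (hK₂ : K₂.space = P)
    (hbd : {s ∈ K₁.faces | convexHull ℝ (s : Set (Fin n → ℝ)) ⊆ frontier P} =
           {s ∈ K₂.faces | convexHull ℝ (s : Set (Fin n → ℝ)) ⊆ frontier P}) :
    ∃ (s : ℕ) (B₁ B₂ : Geometry.SimplicialComplex ℝ (Fin n → ℝ)),
      IsIterDerived s B₁ K₁ ∧ IsIterDerived s B₂ K₂ ∧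
      {t ∈ B₁.faces | convexHull ℝ (t : Set (Fin n → ℝ)) ⊆ frontier P} =
        {t ∈ B₂.faces | convexHull ℝ (t : Set (Fin n → ℝ)) ⊆ frontier P} ∧
      Relation.ReflTransGen (BistellarMove n) B₁ B₂ := by
  obtain rfl | hn := n.eq_zero_or_pos
  · refine ⟨0, K₁, K₂, rfl, rfl, hbd, ?_⟩
    rw [Geometry.SimplicialComplex.eq_of_subsingleton (K := K₁) (L := K₂)
      (hK₁ ▸ hPflat.mono interior_subset) (hK₂ ▸ hPflat.mono interior_subset)]
  · subst hK₁
    have hd := Module.finrank_fin_fun ℝ (n := n)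
    obtain ⟨s, B₁, B₂, i₁, i₂, s₁, s₂, hb, hB⟩ :=
      exists_isIterDerived_reflTransGen_bistellarMove (hd.symm ▸ hn) hK₁fin hK₂fin hK₂.symm hPstar
        (by simpa only [Geometry.SimplicialComplex.boundaryFaces, hK₂] using hbd)
    rw [hd] at hB
    refine ⟨s, B₁, B₂, i₁, i₂, ?_, hB⟩
    simpa only [Geometry.SimplicialComplex.boundaryFaces, s₁, s₂] using hb
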